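/- Let φ be a locally Hölder potential on X = [0,1]∖ℚ with φ ≤ 0 and P(φ) = 0, μ_φ its Gibbs measure for the Gauss map, ψ = −log|T′|, and s = h_{μ_φ}/λ_{μ_φ} the Hausdorff dimension of μ_φ. Suppose {t ∈ ℝ : P(t(φ − sψ) + φ) < ∞} contains a neighbourhood of the origin. Then for every ε > 0 there exist δ > 0 and n₁ ∈ ℕ such that for all n ≥ n₁, μ_φ({x : |S_nφ(x)/S_nψ(x) − s| > ε}) ≤ e^{−nδ}. -/

import Mathlib

open MeasureTheory Filter Set Topology
open scoped ENNReal NNReal Classical Real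

noncomputable section

/-- The Gauss map `T(x) = 1/x mod 1`. -/
def gaussMap (x : ℝ) : ℝ := Int.fract x⁻¹

/-- The space `X = [0,1] ∖ ℚ` of irrational numbers in the unit interval. -/
def gaussSet : Set ℝ := {x | x ∈ Set.Icc (0:ℝ) 1 ∧ Irrational x}

/-- The first continued fraction digit `a₁(x) = ⌊1/x⌋`. -/
def cfDigit1 (x : ℝ) : ℕ := ⌊x⁻¹⌋₊

/-- The `(i+1)`-th continued fraction digit `a_{i+1}(x) = a₁(Tⁱ x)`. -/
def cfDigit (i : ℕ) (x : ℝ) : ℕ := cfDigit1 (gaussMap^[i] x)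

/-- The inverse branch `T_a(x) = 1/(x+a)` of the Gauss map. -/
def invBranch1 (a : ℕ) (x : ℝ) : ℝ := (x + (a : ℝ))⁻¹

/-- The composed inverse branch `T_𝐚 = T_{a₁} ∘ ⋯ ∘ T_{aₙ}` for `𝐚 = [a₁,…,aₙ]`. -/
def invBranch (l : List ℕ) (x : ℝ) : ℝ := l.foldr invBranch1 x

/-- The cylinder set `I_𝐚` of points of `X` whose first digits are given by `𝐚`. -/
def cylinder (l : List ℕ) : Set ℝ :=
  {x | x ∈ gaussSet ∧ ∀ i : Fin l.length, cfDigit i.1 x = l.get i}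

/-- The Birkhoff sum `S_n φ = ∑_{k<n} φ ∘ T^k`. -/
def birkhoff (φ : ℝ → ℝ) (n : ℕ) (x : ℝ) : ℝ :=
  ∑ k ∈ Finset.range n, φ (gaussMap^[k] x)

/-- The pair `(pₙ(𝐚), qₙ(𝐚))` of numerator and denominator (continuant) of the
finite continued fraction `[a₁,…,aₙ] = pₙ/qₙ`. -/
def contPQ : List ℕ → ℕ × ℕ
  | [] => (0, 1)
  | a :: l => ((contPQ l).2, a * (contPQ l).2 + (contPQ l).1)

/-- The continuant `qₙ(𝐚)`, the denominator of `[a₁,…,aₙ]` in lowest terms. -/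
def contQ (l : List ℕ) : ℕ := (contPQ l).2

/-- Words of length `n` with digits in `ℕ = {1,2,…}`. -/
def Word (n : ℕ) : Type := {l : List ℕ // l.length = n ∧ ∀ a ∈ l, 0 < a}

/-- The periodic point `𝐚^∞` with periodic continued fraction expansion repeating `𝐚`. -/
def periodicPoint (l : List ℕ) : ℝ :=
  limUnder atTop fun k : ℕ => invBranch (List.flatten (List.replicate k l)) (1/2 : ℝ)

/-- The `n`-th partition sum `∑_{𝐚 ∈ ℕⁿ} exp(S_nφ(𝐚^∞))` appearing in the pressure. -/
def partSum (φ : ℝ → ℝ) (n : ℕ) : ℝ≥0∞ :=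
  ∑' l : Word n, ENNReal.ofReal (Real.exp (birkhoff φ n (periodicPoint l.1)))

/-- `φ` has (finite) pressure `P(φ) = p`, i.e. `(1/n) log ∑_{𝐚∈ℕⁿ} exp(S_nφ(𝐚^∞)) → p`. -/
def HasPressure (φ : ℝ → ℝ) (p : ℝ) : Prop :=
  (∀ n : ℕ, 0 < n → partSum φ n ≠ ⊤) ∧
    Tendsto (fun n : ℕ => Real.log (partSum φ n).toReal / (n : ℝ)) atTop (𝓝 p)

/-- The pressure of `φ` is finite: `P(φ) < ∞`. -/
def PressureFinite (φ : ℝ → ℝ) : Prop := ∃ p : ℝ, HasPressure φ p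

/-- `φ` is locally Hölder: oscillation on `n`-cylinders decays geometrically. -/
def LocHolder (φ : ℝ → ℝ) : Prop :=
  ∃ C > (0:ℝ), ∃ θ ∈ Set.Ioo (0:ℝ) 1, ∀ l : List ℕ, l ≠ [] → (∀ a ∈ l, 0 < a) →
    ∀ x ∈ cylinder l, ∀ y ∈ cylinder l, |φ x - φ y| ≤ C * θ ^ l.length

/-- The normalization `𝓛_φ 1 = 1` of the Ruelle transfer operator of `φ`. -/
def TransferNormalized (φ : ℝ → ℝ) : Prop :=
  ∀ x ∈ gaussSet, ∑' a : ℕ+, Real.exp (φ (invBranch1 (a : ℕ) x)) = 1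

/-- `μ` is invariant under the Gauss map. -/
def GaussInvariant (μ : Measure ℝ) : Prop :=
  ∀ s : Set ℝ, MeasurableSet s → μ (gaussMap ⁻¹' s) = μ s

/-- The Gibbs property for the potential `φ` (with `P(φ) = 0`):
`C⁻¹ e^{S_nφ(T_𝐚 x)} ≤ μ(I_𝐚) ≤ C e^{S_nφ(T_𝐚 x)}`. -/
def IsGibbs (φ : ℝ → ℝ) (μ : Measure ℝ) : Prop :=
  ∃ C : ℝ, 1 ≤ C ∧ ∀ l : List ℕ, l ≠ [] → (∀ a ∈ l, 0 < a) → ∀ x ∈ gaussSet,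
    C⁻¹ * Real.exp (birkhoff φ l.length (invBranch l x)) ≤ (μ (cylinder l)).toReal ∧
      (μ (cylinder l)).toReal ≤ C * Real.exp (birkhoff φ l.length (invBranch l x))

/-- The Kolmogorov–Sinai entropy of `μ`:
`h = lim (1/n) ∑_{𝐚∈ℕⁿ} -μ(I_𝐚) log μ(I_𝐚)`. -/
def HasEntropy (μ : Measure ℝ) (h : ℝ) : Prop :=
  Tendsto (fun n : ℕ => (∑' l : Word n, Real.negMulLog (μ (cylinder l.1)).toReal) / (n : ℝ))
    atTop (𝓝 h)

/-- `log |T'| (x) = log (1/x²)` for the Gauss map. -/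
def logAbsDerivGauss (x : ℝ) : ℝ := Real.log (1 / x ^ 2)

/-- The observable `ψ = -log |T'|`. -/
def gaussPsi (x : ℝ) : ℝ := -Real.log (1 / x ^ 2)

/-- The Lyapunov exponent `λ_μ = ∫ log|T'| dμ`. -/
def lyapunov (μ : Measure ℝ) : ℝ := ∫ x, logAbsDerivGauss x ∂μ

/-- The polynomial tail condition `μ({x : a₁(x) ≥ n}) = O(n^{-δ})`. -/
def PolyTail (μ : Measure ℝ) : Prop :=
  ∃ δ > (0:ℝ), ∃ K : ℝ, ∀ n : ℕ, 0 < n →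
    (μ {x | x ∈ gaussSet ∧ n ≤ cfDigit1 x}).toReal ≤ K * (n : ℝ) ^ (-δ)

/-- The Fourier transform `μ̂(ξ) = ∫ e^{-2πiξx} dμ(x)`. -/
def muFourier (μ : Measure ℝ) (ξ : ℝ) : ℂ :=
  ∫ x, Complex.exp (-(2 * Real.pi * ξ * x : ℝ) * Complex.I) ∂μ

/-- A sequence `u` equidistributes modulo 1. -/
def EquidistributedMod1 (u : ℕ → ℝ) : Prop :=
  ∀ a b : ℝ, 0 ≤ a → a ≤ b → b ≤ 1 →
    Tendsto (fun N : ℕ =>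
        (((Finset.range N).filter fun k => Int.fract (u k) ∈ Set.Ico a b).card : ℝ) / (N : ℝ))
      atTop (𝓝 (b - a))

/-- The set `B(𝒜)` of `𝒜`-badly approximable numbers: all digits lie in `𝒜`. -/
def badSet (A : Finset ℕ) : Set ℝ := {x | x ∈ gaussSet ∧ ∀ i : ℕ, cfDigit i x ∈ A}

/-- Locally Hölder on the subsystem `B(𝒜)`. -/
def LocHolderOn (A : Finset ℕ) (φ : ℝ → ℝ) : Prop :=
  ∃ C > (0:ℝ), ∃ θ ∈ Set.Ioo (0:ℝ) 1, ∀ l : List ℕ, l ≠ [] → (∀ a ∈ l, a ∈ A) →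
    ∀ x ∈ cylinder l ∩ badSet A, ∀ y ∈ cylinder l ∩ badSet A,
      |φ x - φ y| ≤ C * θ ^ l.length

/-- The Gibbs property for the Gauss map restricted to `B(𝒜)`. -/
def IsGibbsOn (A : Finset ℕ) (φ : ℝ → ℝ) (μ : Measure ℝ) : Prop :=
  ∃ C : ℝ, 1 ≤ C ∧ ∀ l : List ℕ, l ≠ [] → (∀ a ∈ l, a ∈ A) → ∀ x ∈ badSet A,
    C⁻¹ * Real.exp (birkhoff φ l.length (invBranch l x)) ≤ (μ (cylinder l)).toReal ∧
      (μ (cylinder l)).toReal ≤ C * Real.exp (birkhoff φ l.length (invBranch l x))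

/-- The `n`-regular set `A_n(ε)` of the large deviation decomposition. -/
def regSet (φ : ℝ → ℝ) (lam s ε : ℝ) (n : ℕ) : Set ℝ :=
  {x | |birkhoff gaussPsi n x / (n : ℝ) + lam| < ε ∧
       |birkhoff φ n x / birkhoff gaussPsi n x - s| < ε}

/-- The collection `𝓡ₙ` of `n`-regular words. -/
def regWords (φ : ℝ → ℝ) (lam s ε : ℝ) (n : ℕ) : Set (List ℕ) :=
  {l | l.length = n ∧ (∀ a ∈ l, 0 < a) ∧
       ∀ k : ℕ, n / 2 ≤ k → k ≤ n → cylinder (l.take k) ⊆ regSet φ lam s ε k}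

/-- The union `Rₙ` of the `n`-regular cylinders. -/
def regUnion (φ : ℝ → ℝ) (lam s ε : ℝ) (n : ℕ) : Set ℝ :=
  ⋃ l ∈ regWords φ lam s ε n, cylinder l

end

/-- A measure preserving system `(μ, T)` with codings `w n` whose law on consecutive blocks is
comparable, up to the factor `K`, with the product law. -/
structure QuasiBernoulli {Ω : Type*} [MeasurableSpace Ω] (μ : Measure Ω) (T : Ω → Ω)
    {α : ℕ → Type*} [∀ n, MeasurableSpace (α n)] (w : ∀ n, Ω → α n) (K : ℝ≥0) : Prop where
  measurePreserving : MeasurePreserving T μ μ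
  measurable : ∀ n, Measurable (w n)
  one_le : 1 ≤ K
  le_prod : ∀ n m, 1 ≤ n → 1 ≤ m →
    μ.map (fun x => (w n x, w m (T^[n] x))) ≤ K • (μ.map (w n)).prod (μ.map (w m))
  prod_le : ∀ n m, 1 ≤ n → 1 ≤ m →
    (μ.map (w n)).prod (μ.map (w m)) ≤ K • μ.map (fun x => (w n x, w m (T^[n] x)))

/-- Up to an error `B`, the Birkhoff sums of `f` are functions `F n` of the coding `w n`. -/
def CodedBy {Ω : Type*} [MeasurableSpace Ω] (μ : Measure Ω) (T : Ω → Ω)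
    {α : ℕ → Type*} (w : ∀ n, Ω → α n) (f : Ω → ℝ) (F : ∀ n, α n → ℝ) (B : ℝ) : Prop :=
  ∀ n, 1 ≤ n → ∀ᵐ x ∂μ, |birkhoffSum T f n x - F n (w n x)| ≤ B

/-- The exponential moment `∫ exp (t S_n f) dμ` of a Birkhoff sum. -/
noncomputable def expMoment {Ω : Type*} [MeasurableSpace Ω] (μ : Measure Ω) (T : Ω → Ω) (f : Ω → ℝ)
    (t : ℝ) (n : ℕ) : ℝ≥0∞ :=
  ∫⁻ x, ENNReal.ofReal (Real.exp (t * birkhoffSum T f n x)) ∂μ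

lemma exp_neg_add_exp_neg_le {a b δ : ℝ} {n : ℕ} (hδ : 0 < δ) (ha : δ ≤ a) (hb : δ ≤ b)
    (hn : ⌈Real.log 2 / (δ / 2)⌉₊ ≤ n) :
    Real.exp (-(n * a)) + Real.exp (-(n * b)) ≤ Real.exp (-(n * (δ / 2))) := by
  have h1 : Real.log 2 ≤ n * (δ / 2) := by
    rw [← div_le_iff₀ (by positivity)]
    exact Nat.ceil_le.1 hn
  have h2 : ∀ c, δ ≤ c → Real.exp (-(n * c)) ≤ Real.exp (-(n * δ)) := fun c hc => by gcongr
  calc _ ≤ 2 * Real.exp (-(n * δ)) := by linarith [h2 a ha, h2 b hb]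
    _ = Real.exp (Real.log 2 + -(n * δ)) := by rw [Real.exp_add, Real.exp_log (by norm_num)]
    _ ≤ _ := Real.exp_le_exp.2 (by linarith)

section CodedBy

variable {Ω : Type*} [MeasurableSpace Ω] {μ : Measure Ω} {T : Ω → Ω} {α : ℕ → Type*}
  {w : ∀ n, Ω → α n} {f : Ω → ℝ} {F : ∀ n, α n → ℝ} {B : ℝ}

lemma CodedBy.neg (hF : CodedBy μ T w f F B) :
    CodedBy μ T w (fun x => -f x) (fun n a => -F n a) B := by
  intro n hn
  filter_upwards [hF n hn] with x hx
  rw [← abs_neg]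
  convert hx using 2
  simp [birkhoffSum]
  ring

lemma CodedBy.sub_const (hF : CodedBy μ T w f F B) (c : ℝ) :
    CodedBy μ T w (fun x => f x - c) (fun n a => F n a - n * c) B := by
  intro n hn
  filter_upwards [hF n hn] with x hx
  convert hx using 2
  simp [birkhoffSum]

end CodedBy

section Abstract

variable {Ω : Type*} [MeasurableSpace Ω] {μ : Measure Ω} {T : Ω → Ω}
  {α : ℕ → Type*} [∀ n, MeasurableSpace (α n)] [∀ n, Countable (α n)]
  [∀ n, MeasurableSingletonClass (α n)] {w : ∀ n, Ω → α n} {K : ℝ≥0}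
  {f : Ω → ℝ} {F : ∀ n, α n → ℝ} {B : ℝ}

lemma aemeasurable_birkhoffSum (hT : MeasurePreserving T μ μ) (hf : AEMeasurable f μ) (n : ℕ) :
    AEMeasurable (birkhoffSum T f n) μ := by
  unfold birkhoffSum
  exact Finset.aemeasurable_fun_sum _ fun k _ =>
    hf.comp_quasiMeasurePreserving (hT.iterate k).quasiMeasurePreserving

lemma memLp_birkhoffSum (hT : MeasurePreserving T μ μ) {p : ℝ≥0∞} (hf : MemLp f p μ) (n : ℕ) :
    MemLp (birkhoffSum T f n) p μ := by
  unfold birkhoffSum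
  exact memLp_finsetSum _ fun k _ => hf.comp_measurePreserving (hT.iterate k)

lemma integral_birkhoffSum (hT : MeasurePreserving T μ μ) (hf : Integrable f μ) (n : ℕ) :
    ∫ x, birkhoffSum T f n x ∂μ = n * ∫ x, f x ∂μ := by
  unfold birkhoffSum
  rw [integral_finsetSum]
  · rw [Finset.sum_congr rfl (g := fun _ => ∫ x, f x ∂μ)]
    · simp
    · intro k _
      have h := integral_map (hT.iterate k).measurable.aemeasurable
        (f := f) (by rw [(hT.iterate k).map_eq]; exact hf.1)
      rw [(hT.iterate k).map_eq] at h
      exact h.symm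
  · exact fun k _ => (hT.iterate k).integrable_comp_of_integrable hf

variable [IsProbabilityMeasure μ]

lemma expMoment_add_le (hQ : QuasiBernoulli μ T w K) (hF : CodedBy μ T w f F B)
    {t : ℝ} (ht : 0 ≤ t) {n m : ℕ} (hn : 1 ≤ n) (hm : 1 ≤ m) :
    expMoment μ T f t (n + m) ≤
      ENNReal.ofReal (K * Real.exp (4 * t * B)) *
        (expMoment μ T f t n *
          expMoment μ T f t m) := by
  have hT := hQ.measurePreserving
  have e : ENNReal.ofReal (K * Real.exp (4 * t * B)) =
      ENNReal.ofReal (Real.exp (2 * t * B)) * ((K : ℝ≥0∞) *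
        (ENNReal.ofReal (Real.exp (t * B)) * ENNReal.ofReal (Real.exp (t * B)))) := by
    rw [← ENNReal.ofReal_mul (by positivity), ← Real.exp_add, ENNReal.ofReal_mul (by positivity),
      ENNReal.ofReal_coe_nnreal, mul_left_comm, ← ENNReal.ofReal_mul (by positivity),
      ← Real.exp_add]
    ring_nf
  let g : ∀ n, α n → ℝ≥0∞ := fun n a => ENNReal.ofReal (Real.exp (t * F n a))
  have hg : ∀ n, Measurable (g n) := fun n => measurable_of_countable _
  have hgM : ∀ n, 1 ≤ n → ∫⁻ a, g n a ∂(μ.map (w n)) ≤ ENNReal.ofReal (Real.exp (t * B)) *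
      expMoment μ T f t n := by
    intro n hn
    rw [lintegral_map (hg n) (hQ.measurable n), expMoment, ← lintegral_const_mul' _ _ ENNReal.ofReal_ne_top]
    refine lintegral_mono_ae ?_
    filter_upwards [hF n hn] with x hx
    simp only [g]
    rw [← ENNReal.ofReal_mul (by positivity), ← Real.exp_add]
    gcongr
    rw [← mul_add]
    gcongr
    linarith [(abs_le.1 hx).1]
  have hpair : Measurable fun x => (w n x, w m (T^[n] x)) :=
    (hQ.measurable n).prodMk ((hQ.measurable m).comp (hT.iterate n).measurable)
  have hm' := (hT.iterate n).quasiMeasurePreserving.ae (hF m hm)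
  calc
    _ ≤ ∫⁻ x, ENNReal.ofReal (Real.exp (2 * t * B)) *
          (g n (w n x) * g m (w m (T^[n] x))) ∂μ := by
        refine lintegral_mono_ae ?_
        filter_upwards [hF n hn, hm'] with x hx hy
        simp only [g]
        rw [← ENNReal.ofReal_mul (by positivity), ← ENNReal.ofReal_mul (by positivity),
          ← Real.exp_add, ← Real.exp_add, birkhoffSum_add]
        gcongr
        have := mul_le_mul_of_nonneg_left (abs_le.1 hx).2 ht
        have := mul_le_mul_of_nonneg_left (abs_le.1 hy).2 ht
        linarith
    _ = ENNReal.ofReal (Real.exp (2 * t * B)) *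
          ∫⁻ p, g n p.1 * g m p.2 ∂(μ.map (fun x => (w n x, w m (T^[n] x)))) := by
        rw [lintegral_const_mul' _ _ ENNReal.ofReal_ne_top, lintegral_map (by fun_prop) hpair]
    _ ≤ ENNReal.ofReal (Real.exp (2 * t * B)) *
          ((K : ℝ≥0∞) * ((∫⁻ a, g n a ∂(μ.map (w n))) * ∫⁻ a, g m a ∂(μ.map (w m)))) := by
        gcongr
        refine (lintegral_mono' (hQ.le_prod n m hn hm) le_rfl).trans ?_
        rw [lintegral_smul_measure, lintegral_prod_mul (hg n).aemeasurable (hg m).aemeasurable]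
        rfl
    _ ≤ ENNReal.ofReal (Real.exp (2 * t * B)) * ((K : ℝ≥0∞) *
          ((ENNReal.ofReal (Real.exp (t * B)) *
            expMoment μ T f t n) *
          (ENNReal.ofReal (Real.exp (t * B)) *
            expMoment μ T f t m))) := by
        gcongr
        · exact hgM n hn
        · exact hgM m hm
    _ = _ := by rw [e]; ring

lemma integral_sq_birkhoffSum_add_self_le (hQ : QuasiBernoulli μ T w K)
    (hF : CodedBy μ T w f F B) (hf : MemLp f 2 μ) (hf0 : ∫ x, f x ∂μ = 0) {n : ℕ} (hn : 1 ≤ n) :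
    ∫ x, birkhoffSum T f (n + n) x ^ 2 ∂μ ≤
      (4 - 1 / (2 * K)) * ∫ x, birkhoffSum T f n x ^ 2 ∂μ + 6 * B ^ 2 := by
  have hT := hQ.measurePreserving
  set X := birkhoffSum T f n with hXdef
  set Y : Ω → ℝ := fun x => X (T^[n] x) with hYdef
  have hX : MemLp X 2 μ := memLp_birkhoffSum hT hf n
  have hY : MemLp Y 2 μ := hX.comp_measurePreserving (hT.iterate n)
  have hX0 : ∫ x, X x ∂μ = 0 := by
    rw [hXdef, integral_birkhoffSum hT (hf.integrable (by norm_num)), hf0, mul_zero]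
  have hYv : ∫ x, Y x ^ 2 ∂μ = ∫ x, X x ^ 2 ∂μ := by
    have h := integral_map (μ := μ) (hT.iterate n).measurable.aemeasurable
      (f := fun x => X x ^ 2) (by rw [(hT.iterate n).map_eq]; exact hX.integrable_sq.1)
    rw [(hT.iterate n).map_eq] at h
    exact h.symm
  set v := ∫ x, X x ^ 2 ∂μ with hv
  set E := ∫ x, (X x - Y x) ^ 2 ∂μ with hE
  have hDi : Integrable (fun x => (X x - Y x) ^ 2) μ := (hX.sub hY).integrable_sq
  have hpar : ∫ x, (X x + Y x) ^ 2 ∂μ + E = 4 * v := by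
    have hSi : Integrable (fun x => (X x + Y x) ^ 2) μ := (hX.add hY).integrable_sq
    rw [hE, ← integral_add hSi hDi]
    have : (fun x => (X x + Y x) ^ 2 + (X x - Y x) ^ 2) = fun x => 2 * X x ^ 2 + 2 * Y x ^ 2 := by
      ext x; ring
    rw [this, integral_add (hX.integrable_sq.const_mul 2) (hY.integrable_sq.const_mul 2),
      integral_const_mul, integral_const_mul, hYv]
    ring
  have hsq : ∀ a b c d : ℝ, |a - c| ≤ B → |b - d| ≤ B →
      (a - b) ^ 2 ≤ 2 * (c - d) ^ 2 + 8 * B ^ 2 := by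
    intro a b c d h1 h2
    have h3 : |(a - c) - (b - d)| ≤ 2 * B := (abs_sub _ _).trans (by linarith)
    have h4 : ((a - c) - (b - d)) ^ 2 ≤ (2 * B) ^ 2 := sq_le_sq' (abs_le.1 h3).1 (abs_le.1 h3).2
    nlinarith [sq_nonneg ((c - d) - ((a - c) - (b - d)))]
  have hK0 : (0 : ℝ) < K := lt_of_lt_of_le one_pos (by exact_mod_cast hQ.one_le)
  have hcomp : 2 * v ≤ K * (4 * E + 24 * B ^ 2) := by
    have hvprod : ∫ p, (X p.1 - X p.2) ^ 2 ∂(μ.prod μ) = 2 * v := by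
      have h1 : Integrable (fun p : Ω × Ω => X p.1 ^ 2) (μ.prod μ) := hX.integrable_sq.comp_fst μ
      have h2 : Integrable (fun p : Ω × Ω => X p.2 ^ 2) (μ.prod μ) := hX.integrable_sq.comp_snd μ
      have h3 : Integrable (fun p : Ω × Ω => X p.1 * X p.2) (μ.prod μ) :=
        (hX.integrable (by norm_num)).mul_prod (hX.integrable (by norm_num))
      have : (fun p : Ω × Ω => (X p.1 - X p.2) ^ 2) =
          fun p => (X p.1 ^ 2 + X p.2 ^ 2) - 2 * (X p.1 * X p.2) := by ext p; ring
      rw [this, integral_sub (by exact h1.add h2) (h3.const_mul 2), integral_add h1 h2,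
        integral_const_mul, integral_prod_mul, hX0, integral_fun_fst (fun x => X x ^ 2),
        integral_fun_snd (fun x => X x ^ 2)]
      simp
      ring
    have hint : Integrable (fun p : Ω × Ω => (X p.1 - X p.2) ^ 2) (μ.prod μ) :=
      ((hX.comp_fst μ).sub (hX.comp_snd μ)).integrable_sq
    let G : α n × α n → ℝ≥0∞ :=
      fun p => ENNReal.ofReal (2 * (F n p.1 - F n p.2) ^ 2 + 8 * B ^ 2)
    have hG : Measurable G := measurable_of_countable _
    have hpair : Measurable fun x => (w n x, w n (T^[n] x)) :=
      (hQ.measurable n).prodMk ((hQ.measurable n).comp (hT.iterate n).measurable)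
    have hfin : ENNReal.ofReal (2 * v) ≤ ENNReal.ofReal (K * (4 * E + 24 * B ^ 2)) := by
      calc ENNReal.ofReal (2 * v)
          = ∫⁻ p, ENNReal.ofReal ((X p.1 - X p.2) ^ 2) ∂(μ.prod μ) := by
            rw [← hvprod, ofReal_integral_eq_lintegral_ofReal hint
              (ae_of_all _ fun _ => sq_nonneg _)]
        _ ≤ ∫⁻ p, G (Prod.map (w n) (w n) p) ∂(μ.prod μ) := by
            refine lintegral_mono_ae ?_
            filter_upwards [Measure.quasiMeasurePreserving_fst.ae (hF n hn),
              Measure.quasiMeasurePreserving_snd.ae (hF n hn)] with p h1 h2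
            exact ENNReal.ofReal_le_ofReal (hsq _ _ _ _ h1 h2)
        _ = ∫⁻ p, G p ∂((μ.map (w n)).prod (μ.map (w n))) := by
            rw [Measure.map_prod_map _ _ (hQ.measurable n) (hQ.measurable n),
              lintegral_map hG ((hQ.measurable n).prodMap (hQ.measurable n))]
        _ ≤ (K : ℝ≥0∞) * ∫⁻ p, G p ∂(μ.map (fun x => (w n x, w n (T^[n] x)))) := by
            refine (lintegral_mono' (hQ.prod_le n n hn hn) le_rfl).trans ?_
            rw [lintegral_smul_measure]
            rfl
        _ ≤ (K : ℝ≥0∞) * ∫⁻ x, ENNReal.ofReal (4 * (X x - Y x) ^ 2 + 24 * B ^ 2) ∂μ := by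
            rw [lintegral_map hG hpair]
            gcongr 1
            refine lintegral_mono_ae ?_
            filter_upwards [hF n hn, (hT.iterate n).quasiMeasurePreserving.ae (hF n hn)]
              with x h1 h2
            refine ENNReal.ofReal_le_ofReal ?_
            have := hsq (F n (w n x)) (F n (w n (T^[n] x))) (X x) (Y x)
              (by rw [abs_sub_comm]; exact h1) (by rw [abs_sub_comm]; exact h2)
            linarith
        _ = ENNReal.ofReal (K * (4 * E + 24 * B ^ 2)) := by
            have hi : Integrable (fun x => 4 * (X x - Y x) ^ 2 + 24 * B ^ 2) μ :=
              (hDi.const_mul 4).add (integrable_const _)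
            rw [← ofReal_integral_eq_lintegral_ofReal hi (ae_of_all _ fun _ => by positivity),
              ENNReal.ofReal_mul (by positivity), ENNReal.ofReal_coe_nnreal,
              integral_add (hDi.const_mul 4) (integrable_const _)]
            rw [integral_const_mul]
            simp [hE]
    refine (ENNReal.ofReal_le_ofReal_iff ?_).1 hfin
    have : 0 ≤ E := integral_nonneg fun _ => sq_nonneg _
    positivity
  have hE' : v / (2 * K) - 6 * B ^ 2 ≤ E := by
    rw [sub_le_iff_le_add, div_le_iff₀ (by positivity)]
    linarith
  have hsum : (fun x => birkhoffSum T f (n + n) x ^ 2) = fun x => (X x + Y x) ^ 2 := by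
    ext x; rw [birkhoffSum_add]
  rw [hsum]
  have : (4 - 1 / (2 * (K : ℝ))) * v = 4 * v - v / (2 * K) := by ring
  rw [this]
  linarith

lemma integral_sq_birkhoffSum_two_pow_le (hQ : QuasiBernoulli μ T w K)
    (hF : CodedBy μ T w f F B) (hf : MemLp f 2 μ) (hf0 : ∫ x, f x ∂μ = 0) (j : ℕ) :
    ∫ x, birkhoffSum T f (2 ^ j) x ^ 2 ∂μ ≤
      (4 - 1 / (2 * K)) ^ j * (∫ x, f x ^ 2 ∂μ + 6 * B ^ 2) - 6 * B ^ 2 := by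
  have hK : (1 : ℝ) ≤ K := by exact_mod_cast hQ.one_le
  have hq : 1 / (2 * (K : ℝ)) ≤ 1 := by
    rw [div_le_one (by positivity)]; linarith
  induction j with
  | zero => simp [birkhoffSum]
  | succ j ih =>
    rw [pow_succ 2 j, mul_two]
    refine (integral_sq_birkhoffSum_add_self_le hQ hF hf hf0 Nat.one_le_two_pow).trans ?_
    generalize 1 / (2 * (K : ℝ)) = q at ih hq ⊢
    have h1 := mul_le_mul_of_nonneg_left ih (by linarith : 0 ≤ 4 - q)
    have h2 := mul_le_mul_of_nonneg_right hq (sq_nonneg B)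
    rw [pow_succ (4 - q)]
    linarith [sq_nonneg B]

lemma expMoment_add_le' (hQ : QuasiBernoulli μ T w K) (hF : CodedBy μ T w f F B)
    (hB : 0 ≤ B) {t t₀ : ℝ} (ht : 0 ≤ t) (htt : t ≤ t₀) {n m : ℕ} (hn : 1 ≤ n) (hm : 1 ≤ m) :
    expMoment μ T f t (n + m) ≤ ENNReal.ofReal (K * Real.exp (4 * t₀ * B)) *
      (expMoment μ T f t n * expMoment μ T f t m) := by
  refine (expMoment_add_le hQ hF ht hn hm).trans ?_
  gcongr

/-- The constant `A` bounding the growth rate of the exponential moments. -/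
lemma exists_expMoment_le_pow (hQ : QuasiBernoulli μ T w K) (hF : CodedBy μ T w f F B)
    (hB : 0 ≤ B) {t₀ : ℝ} (ht₀ : 0 < t₀)
    (hexp : Integrable (fun x => Real.exp (t₀ * f x)) μ) :
    ∃ A : ℝ, 1 ≤ A ∧ ∀ n, 1 ≤ n → expMoment μ T f t₀ n ≤ ENNReal.ofReal (A ^ n) := by
  set K' : ℝ := K * Real.exp (4 * t₀ * B) with hK'
  have hK1 : 1 ≤ K' := one_le_mul_of_one_le_of_one_le (by exact_mod_cast hQ.one_le)
    (Real.one_le_exp (by positivity))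
  set I := ∫ x, Real.exp (t₀ * f x) ∂μ with hI
  have hI0 : 0 ≤ I := integral_nonneg fun _ => (Real.exp_pos _).le
  have h1 : expMoment μ T f t₀ 1 = ENNReal.ofReal I := by
    rw [hI, ofReal_integral_eq_lintegral_ofReal hexp (ae_of_all _ fun _ => (Real.exp_pos _).le)]
    simp [expMoment, birkhoffSum]
  refine ⟨max 1 (K' * I), le_max_left _ _, fun n hn => ?_⟩
  induction n, hn using Nat.le_induction with
  | base =>
    rw [h1, pow_one]
    exact ENNReal.ofReal_le_ofReal ((le_mul_of_one_le_left hI0 hK1).trans (le_max_right _ _))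
  | succ n hn ih =>
    refine (expMoment_add_le' hQ hF hB ht₀.le le_rfl hn le_rfl).trans ?_
    calc ENNReal.ofReal K' * (expMoment μ T f t₀ n * expMoment μ T f t₀ 1)
        ≤ ENNReal.ofReal K' * (ENNReal.ofReal (max 1 (K' * I) ^ n) * ENNReal.ofReal I) := by
          rw [h1]; gcongr
      _ = ENNReal.ofReal (max 1 (K' * I) ^ n * (K' * I)) := by
          rw [← ENNReal.ofReal_mul (by positivity), ← ENNReal.ofReal_mul (by positivity)]
          congr 1; ring
      _ ≤ _ := by
          rw [pow_succ]
          gcongr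
          exact le_max_right _ _

/-- A pointwise bound for `exp (c s / m)` by a constant, a large exponential moment and a
square. -/
lemma exp_le_three_halves_add {A c t₀ m s : ℝ} (hA : 1 ≤ A) (hc : 0 < c) (ht₀ : 0 < t₀)
    (hm : 0 < m) (hmc : 2 * c / t₀ ≤ m) :
    Real.exp (c / m * s) ≤ 3 / 2 + 1 / 8 + 1 / 8 / A ^ m * Real.exp (t₀ * s) +
      8 * A ^ (2 * c / t₀) / ((Real.log (3 / 2) / c) ^ 2 * m ^ 2) * s ^ 2 := by
  have hl : 0 < Real.log (3 / 2) := Real.log_pos (by norm_num)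
  have hA0 : 0 < A := by linarith
  set r := Real.log (3 / 2) / c with hr
  have hr0 : 0 < r := div_pos hl hc
  set P := A ^ (2 * c / t₀) with hP
  have hP0 : 0 < P := Real.rpow_pos_of_pos hA0 _
  have hAm : 0 < A ^ m := Real.rpow_pos_of_pos hA0 _
  have hlast : 0 ≤ 8 * P / (r ^ 2 * m ^ 2) * s ^ 2 := by positivity
  have hmid : 0 ≤ 1 / 8 / A ^ m * Real.exp (t₀ * s) := by positivity
  rcases le_or_gt (s / m) r with h | h
  · have : Real.exp (c / m * s) ≤ 3 / 2 := by
      rw [← Real.exp_log (show (0 : ℝ) < 3 / 2 by norm_num)]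
      refine Real.exp_le_exp.2 ?_
      calc c / m * s = c * (s / m) := by ring
        _ ≤ c * r := by gcongr
        _ = _ := by rw [hr]; field_simp
    linarith
  · set l := 2 * c / (m * t₀) with hl'
    have hl1 : l ≤ 1 := by
      rw [hl', div_le_one (by positivity)]
      rw [div_le_iff₀ ht₀] at hmc
      linarith
    have hl0 : 0 ≤ l := by positivity
    set y := Real.exp (t₀ * s) / A ^ m with hy
    have hy0 : 0 < y := by positivity
    have hyl : y ^ l ≤ 1 + y := by
      rcases le_total y 1 with h1 | h1
      · have := Real.rpow_le_one hy0.le h1 hl0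
        linarith
      · have := Real.rpow_le_rpow_of_exponent_le h1 hl1
        rw [Real.rpow_one] at this
        linarith
    have hsq : Real.exp (c / m * s) ^ 2 = y ^ l * P := by
      rw [hy, Real.div_rpow (Real.exp_pos _).le hAm.le, ← Real.rpow_mul hA0.le, ← Real.exp_mul]
      have h1 : m * l = 2 * c / t₀ := by rw [hl']; field_simp
      rw [h1, ← hP, div_mul_cancel₀ _ hP0.ne', ← Real.exp_nat_mul]
      congr 1
      rw [hl']; push_cast; field_simp
    have hU : 1 ≤ s ^ 2 / (r ^ 2 * m ^ 2) := by
      rw [one_le_div (by positivity), ← mul_pow]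
      rw [lt_div_iff₀ hm] at h
      exact pow_le_pow_left₀ (by positivity) h.le 2
    set e := Real.exp (c / m * s) with he
    have hamgm : e ≤ e ^ 2 / (8 * P) + 8 * P := by
      have h1 : 0 ≤ (e - 4 * P) ^ 2 := sq_nonneg _
      have h2 : e - 8 * P ≤ e ^ 2 / (8 * P) := by
        rw [le_div_iff₀ (by positivity)]
        nlinarith
      linarith
    have h3 : e ^ 2 / (8 * P) ≤ 1 / 8 + 1 / 8 / A ^ m * Real.exp (t₀ * s) := by
      rw [hsq, mul_div_mul_right _ _ hP0.ne']
      have : 1 / 8 / A ^ m * Real.exp (t₀ * s) = y / 8 := by rw [hy]; field_simp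
      rw [this]
      linarith
    have h4 : 8 * P ≤ 8 * P / (r ^ 2 * m ^ 2) * s ^ 2 := by
      have := mul_le_mul_of_nonneg_left hU (by positivity : 0 ≤ 8 * P)
      calc 8 * P ≤ 8 * P * (s ^ 2 / (r ^ 2 * m ^ 2)) := by linarith
        _ = _ := by ring
    linarith

lemma exists_expMoment_le_two (hQ : QuasiBernoulli μ T w K) (hF : CodedBy μ T w f F B)
    (hB : 0 ≤ B) (hf : MemLp f 2 μ) (hf0 : ∫ x, f x ∂μ = 0) {t₀ : ℝ} (ht₀ : 0 < t₀)
    (hexp : Integrable (fun x => Real.exp (t₀ * f x)) μ) {c : ℝ} (hc : 0 < c) :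
    ∃ m : ℕ, 1 ≤ m ∧ c / m ≤ t₀ ∧ expMoment μ T f (c / m) m ≤ 2 := by
  obtain ⟨A, hA, hAn⟩ := exists_expMoment_le_pow hQ hF hB ht₀ hexp
  have hT := hQ.measurePreserving
  have hA0 : 0 < A := by linarith
  have hl : 0 < Real.log (3 / 2) := Real.log_pos (by norm_num)
  set D := 8 * A ^ (2 * c / t₀) / (Real.log (3 / 2) / c) ^ 2 with hD
  have hD0 : 0 < D := by positivity
  have hK : (1 : ℝ) ≤ K := by exact_mod_cast hQ.one_le
  have hq : 1 / (2 * (K : ℝ)) ≤ 1 := by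
    rw [div_le_one (by positivity)]; linarith
  have hq0 : 0 < 1 / (2 * (K : ℝ)) := by positivity
  have hlim : Tendsto (fun j : ℕ => D * (((4 - 1 / (2 * (K : ℝ))) / 4) ^ j *
      (∫ x, f x ^ 2 ∂μ + 6 * B ^ 2))) atTop (𝓝 (D * (0 * (∫ x, f x ^ 2 ∂μ + 6 * B ^ 2)))) :=
    ((tendsto_pow_atTop_nhds_zero_of_lt_one (div_nonneg (by linarith) (by norm_num))
      (by rw [div_lt_one (by norm_num)]; linarith)).mul_const _).const_mul _
  simp only [zero_mul, mul_zero] at hlim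
  have h2 : Tendsto (fun j : ℕ => (2 : ℝ) ^ j) atTop atTop :=
    tendsto_pow_atTop_atTop_of_one_lt (by norm_num)
  obtain ⟨j, hj1, hj2⟩ := ((hlim.eventually_le_const (show (0 : ℝ) < 1 / 4 by norm_num)).and
    (h2.eventually_ge_atTop (2 * c / t₀))).exists
  set m : ℕ := 2 ^ j with hm
  have hm1 : 1 ≤ m := Nat.one_le_two_pow
  have hm0 : (0 : ℝ) < m := by exact_mod_cast hm1
  have hmc : 2 * c / t₀ ≤ (m : ℝ) := by rw [hm]; exact_mod_cast hj2
  refine ⟨m, hm1, ?_, ?_⟩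
  · rw [div_le_iff₀ ht₀] at hmc
    rw [div_le_iff₀ hm0]
    linarith
  set V := ∫ x, birkhoffSum T f m x ^ 2 ∂μ with hV
  have hVle : D / (m : ℝ) ^ 2 * V ≤ 1 / 4 := by
    refine le_trans ?_ hj1
    have h := integral_sq_birkhoffSum_two_pow_le hQ hF hf hf0 j
    have hm2 : (m : ℝ) ^ 2 = 4 ^ j := by
      rw [hm]; push_cast; rw [← pow_mul, mul_comm, pow_mul]; norm_num
    rw [hm2, div_pow, div_mul_eq_mul_div, mul_div_assoc]
    gcongr
    rw [div_mul_eq_mul_div]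
    gcongr
    refine h.trans ?_
    have := sq_nonneg B
    linarith
  have hS := memLp_birkhoffSum hT hf m
  have hSm : AEMeasurable (birkhoffSum T f m) μ := hS.1.aemeasurable
  calc expMoment μ T f (c / m) m
      ≤ ∫⁻ x, (ENNReal.ofReal (3 / 2 + 1 / 8) +
          ENNReal.ofReal (1 / 8 / A ^ (m : ℝ)) *
            ENNReal.ofReal (Real.exp (t₀ * birkhoffSum T f m x)) +
          ENNReal.ofReal (D / (m : ℝ) ^ 2) * ENNReal.ofReal (birkhoffSum T f m x ^ 2)) ∂μ := by
        refine lintegral_mono fun x => ?_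
        rw [← ENNReal.ofReal_mul (by positivity), ← ENNReal.ofReal_mul (by positivity),
          ← ENNReal.ofReal_add (by positivity) (by positivity),
          ← ENNReal.ofReal_add (by positivity) (by positivity)]
        refine ENNReal.ofReal_le_ofReal ?_
        refine (exp_le_three_halves_add hA hc ht₀ hm0 hmc).trans (le_of_eq ?_)
        rw [hD, div_div _ _ ((m : ℝ) ^ 2)]
    _ = ENNReal.ofReal (3 / 2 + 1 / 8) +
          ENNReal.ofReal (1 / 8 / A ^ (m : ℝ)) * expMoment μ T f t₀ m +
          ENNReal.ofReal (D / (m : ℝ) ^ 2) * ENNReal.ofReal V := by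
        rw [lintegral_add_right' _ (by fun_prop), lintegral_add_right' _ (by fun_prop),
          lintegral_const_mul' _ _ ENNReal.ofReal_ne_top,
          lintegral_const_mul' _ _ ENNReal.ofReal_ne_top, hV,
          ofReal_integral_eq_lintegral_ofReal hS.integrable_sq (ae_of_all _ fun _ => sq_nonneg _)]
        simp [expMoment]
    _ ≤ ENNReal.ofReal (3 / 2 + 1 / 8) +
          ENNReal.ofReal (1 / 8 / A ^ (m : ℝ)) * ENNReal.ofReal (A ^ m) +
          ENNReal.ofReal (D / (m : ℝ) ^ 2) * ENNReal.ofReal V := by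
        gcongr
        exact hAn m hm1
    _ = ENNReal.ofReal (3 / 2 + 1 / 8 + 1 / 8 / A ^ (m : ℝ) * A ^ m + D / (m : ℝ) ^ 2 * V) := by
        have hV0 : 0 ≤ V := integral_nonneg fun _ => sq_nonneg _
        rw [← ENNReal.ofReal_mul (by positivity), ← ENNReal.ofReal_mul (by positivity),
          ← ENNReal.ofReal_add (by positivity) (by positivity),
          ← ENNReal.ofReal_add (by positivity) (by positivity)]
    _ ≤ ENNReal.ofReal 2 := by
        refine ENNReal.ofReal_le_ofReal ?_
        rw [Real.rpow_natCast, div_mul_cancel₀ _ (by positivity)]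
        linarith
    _ = 2 := by simp

lemma expMoment_add_mul_le (hQ : QuasiBernoulli μ T w K) (hF : CodedBy μ T w f F B)
    (hB : 0 ≤ B) {t t₀ : ℝ} (ht : 0 ≤ t) (htt : t ≤ t₀) {m : ℕ} (hm : 1 ≤ m)
    (hm2 : expMoment μ T f t m ≤ 2) {D : ℝ} (hD : 0 ≤ D) {r : ℕ} (hr : 1 ≤ r)
    (hr2 : expMoment μ T f t r ≤ ENNReal.ofReal D) (k : ℕ) :
    expMoment μ T f t (r + k * m) ≤
      ENNReal.ofReal (D * (2 * (K * Real.exp (4 * t₀ * B))) ^ k) := by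
  induction k with
  | zero => simpa using hr2
  | succ k ih =>
    rw [add_mul, one_mul, ← add_assoc]
    refine (expMoment_add_le' hQ hF hB ht htt (by omega) hm).trans ?_
    calc _ ≤ ENNReal.ofReal (K * Real.exp (4 * t₀ * B)) *
          (ENNReal.ofReal (D * (2 * (K * Real.exp (4 * t₀ * B))) ^ k) * ENNReal.ofReal 2) := by
          gcongr
          simpa using hm2
      _ = _ := by
          rw [← ENNReal.ofReal_mul (by positivity), ← ENNReal.ofReal_mul (by positivity)]
          congr 1; ring

/-- Exponential upper tail bound for the Birkhoff sums of a centred observable. -/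
theorem measure_birkhoffSum_gt_le (hQ : QuasiBernoulli μ T w K) (hF : CodedBy μ T w f F B)
    (hB : 0 ≤ B) (hf : MemLp f 2 μ) (hf0 : ∫ x, f x ∂μ = 0) {t₀ : ℝ} (ht₀ : 0 < t₀)
    (hexp : Integrable (fun x => Real.exp (t₀ * f x)) μ) {η : ℝ} (hη : 0 < η) :
    ∃ δ > (0 : ℝ), ∃ n₁ : ℕ, ∀ n : ℕ, n₁ ≤ n →
      μ {x | n * η < birkhoffSum T f n x} ≤ ENNReal.ofReal (Real.exp (-(n * δ))) := by
  set K' : ℝ := K * Real.exp (4 * t₀ * B) with hK'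
  have hK1 : 1 ≤ K' := one_le_mul_of_one_le_of_one_le (by exact_mod_cast hQ.one_le)
    (Real.one_le_exp (by positivity))
  have hT := hQ.measurePreserving
  obtain ⟨A, hA, hAn⟩ := exists_expMoment_le_pow hQ hF hB ht₀ hexp
  have hlogK : 0 < Real.log (4 * K') := Real.log_pos (by linarith)
  obtain ⟨m, hm1, hmt, hm2⟩ := exists_expMoment_le_two hQ hF hB hf hf0 ht₀ hexp
    (div_pos hlogK hη)
  set t := Real.log (4 * K') / η / m with ht
  have hm0 : (0 : ℝ) < m := by exact_mod_cast hm1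
  have ht0 : 0 < t := by positivity
  set D := 1 + A ^ m with hD
  have hD0 : 0 < D := by positivity
  have hbase : ∀ r, 1 ≤ r → r ≤ m → expMoment μ T f t r ≤ ENNReal.ofReal D := by
    intro r hr hrm
    calc expMoment μ T f t r
        ≤ ∫⁻ x, (1 + ENNReal.ofReal (Real.exp (t₀ * birkhoffSum T f r x))) ∂μ := by
          refine lintegral_mono fun x => ?_
          rw [← ENNReal.ofReal_one, ← ENNReal.ofReal_add zero_le_one (Real.exp_pos _).le]
          refine ENNReal.ofReal_le_ofReal ?_
          rcases le_total 0 (birkhoffSum T f r x) with h | h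
          · have : Real.exp (t * birkhoffSum T f r x) ≤ Real.exp (t₀ * birkhoffSum T f r x) := by
              gcongr
            linarith
          · have : Real.exp (t * birkhoffSum T f r x) ≤ 1 :=
              Real.exp_le_one_iff.2 (mul_nonpos_of_nonneg_of_nonpos ht0.le h)
            have := Real.exp_pos (t₀ * birkhoffSum T f r x)
            linarith
      _ = 1 + expMoment μ T f t₀ r := by
          rw [lintegral_add_left measurable_const]
          simp [expMoment]
      _ ≤ ENNReal.ofReal 1 + ENNReal.ofReal (A ^ m) := by
          rw [ENNReal.ofReal_one]
          gcongr
          refine (hAn r hr).trans (ENNReal.ofReal_le_ofReal ?_)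
          exact pow_le_pow_right₀ hA hrm
      _ = _ := by rw [hD, ENNReal.ofReal_add zero_le_one (by positivity)]
  have hlog2 : 0 < Real.log 2 := Real.log_pos (by norm_num)
  refine ⟨Real.log 2 / (2 * m), by positivity,
    ⌈Real.log (2 * D) * (2 * m) / Real.log 2⌉₊ + 1, fun n hn => ?_⟩
  set k := (n - 1) / m with hk
  set r := (n - 1) % m + 1 with hr
  have hdm : m * k + (n - 1) % m = n - 1 := Nat.div_add_mod _ _
  have hrm : r ≤ m := Nat.mod_lt _ hm1
  have hn1 : 1 ≤ n := by omega
  have hnk : n = r + k * m := by rw [mul_comm k m]; omega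
  have hM : expMoment μ T f t n ≤ ENNReal.ofReal (D * (2 * K') ^ k) := by
    rw [hnk]
    exact expMoment_add_mul_le hQ hF hB ht0.le hmt hm1 hm2 hD0.le (by omega)
      (hbase r (by omega) hrm) k
  have hmeas : AEMeasurable (fun x => ENNReal.ofReal (Real.exp (t * birkhoffSum T f n x))) μ := by
    have := aemeasurable_birkhoffSum hT hf.1.aemeasurable n
    fun_prop
  have hmarkov := mul_meas_ge_le_lintegral₀ hmeas (ENNReal.ofReal (Real.exp (t * (n * η))))
  have hsub : {x | n * η < birkhoffSum T f n x} ⊆ {x | ENNReal.ofReal (Real.exp (t * (n * η))) ≤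
      ENNReal.ofReal (Real.exp (t * birkhoffSum T f n x))} := by
    intro x hx
    have hx' : n * η < birkhoffSum T f n x := hx
    refine ENNReal.ofReal_le_ofReal (Real.exp_le_exp.2 ?_)
    gcongr
  have hexpk : (4 * K') ^ k ≤ Real.exp (t * (n * η)) := by
    rw [← Real.exp_log (show 0 < 4 * K' by linarith), ← Real.exp_nat_mul]
    refine Real.exp_le_exp.2 ?_
    have hnk' : (k : ℝ) * m ≤ n := by exact_mod_cast (by omega : k * m ≤ n)
    calc (k : ℝ) * Real.log (4 * K') = t * (k * m * η) := by rw [ht]; field_simp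
      _ ≤ _ := by gcongr
  have hfin : μ {x | n * η < birkhoffSum T f n x} ≤ ENNReal.ofReal (D / 2 ^ k) := by
    have h1 : ENNReal.ofReal ((4 * K') ^ k) * μ {x | n * η < birkhoffSum T f n x} ≤
        ENNReal.ofReal (D * (2 * K') ^ k) :=
      (mul_le_mul' (ENNReal.ofReal_le_ofReal hexpk) (measure_mono hsub)).trans
        (hmarkov.trans hM)
    have hpos : 0 < (4 * K') ^ k := by positivity
    rw [mul_comm, ← ENNReal.le_div_iff_mul_le (Or.inl (by simpa using hpos))
      (Or.inl ENNReal.ofReal_ne_top), ← ENNReal.ofReal_div_of_pos hpos] at h1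
    refine h1.trans (le_of_eq ?_)
    congr 1
    have : (4 * K') ^ k = (2 * K') ^ k * 2 ^ k := by rw [← mul_pow]; ring_nf
    rw [this]
    field_simp
  refine hfin.trans (ENNReal.ofReal_le_ofReal ?_)
  have hk1 : (n : ℝ) / m - 1 ≤ k := by
    rw [sub_le_iff_le_add, div_le_iff₀ hm0, add_mul, one_mul]
    exact_mod_cast (by omega : n ≤ k * m + m)
  have hnD : Real.log (2 * D) ≤ n * (Real.log 2 / (2 * m)) := by
    have : Real.log (2 * D) * (2 * m) / Real.log 2 ≤ n :=
      (Nat.le_ceil _).trans (Nat.cast_le.2 (by omega))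
    rw [div_le_iff₀ hlog2] at this
    rw [mul_div_assoc', le_div_iff₀ (by positivity)]
    exact this
  have h2k : (2 : ℝ) ^ k = Real.exp (k * Real.log 2) := by
    rw [Real.exp_nat_mul, Real.exp_log (by norm_num)]
  rw [div_le_iff₀ (by positivity), h2k, ← Real.exp_add, ← Real.exp_log hD0]
  refine Real.exp_le_exp.2 ?_
  rw [Real.log_mul (by norm_num) hD0.ne'] at hnD
  have h5 := mul_le_mul_of_nonneg_right hk1 hlog2.le
  have h6 : (n : ℝ) / m * Real.log 2 = 2 * (n * (Real.log 2 / (2 * m))) := by field_simp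
  linarith

/-- Large deviations for Birkhoff sums of observables with exponential moments over a
quasi-Bernoulli system. -/
theorem measure_abs_birkhoffSum_sub_gt_le (hQ : QuasiBernoulli μ T w K)
    (hF : CodedBy μ T w f F B) (hB : 0 ≤ B) {t₀ : ℝ} (ht₀ : 0 < t₀)
    (hexp : Integrable (fun x => Real.exp (t₀ * f x)) μ)
    (hexp' : Integrable (fun x => Real.exp (-t₀ * f x)) μ) {η : ℝ} (hη : 0 < η) :
    ∃ δ > (0 : ℝ), ∃ n₁ : ℕ, ∀ n : ℕ, n₁ ≤ n →
      μ {x | n * η < |birkhoffSum T f n x - n * ∫ y, f y ∂μ|} ≤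
        ENNReal.ofReal (Real.exp (-(n * δ))) := by
  set c := ∫ y, f y ∂μ with hc
  have hf : MemLp f 2 μ := by
    have h0 : 0 ∈ interior (ProbabilityTheory.integrableExpSet f μ) := by
      rw [mem_interior_iff_mem_nhds]
      refine mem_of_superset (Icc_mem_nhds (neg_lt_zero.2 ht₀) ht₀) fun t ht => ?_
      exact ProbabilityTheory.integrable_exp_mul_of_le_of_le hexp' hexp ht.1 ht.2
    exact_mod_cast ProbabilityTheory.memLp_of_mem_interior_integrableExpSet h0 2
  have hfi : Integrable f μ := hf.integrable (by norm_num)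
  have hg : MemLp (fun x => f x - c) 2 μ := hf.sub (memLp_const c)
  have hg0 : ∫ x, (f x - c) ∂μ = 0 := by
    rw [integral_sub hfi (integrable_const c)]; simp [hc]
  have hG := hF.sub_const c
  have hge : Integrable (fun x => Real.exp (t₀ * (f x - c))) μ := by
    refine (hexp.mul_const (Real.exp (-(t₀ * c)))).congr (ae_of_all _ fun x => ?_)
    simp only
    rw [← Real.exp_add]; ring_nf
  have hge' : Integrable (fun x => Real.exp (t₀ * -(f x - c))) μ := by
    refine (hexp'.mul_const (Real.exp (t₀ * c))).congr (ae_of_all _ fun x => ?_)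
    simp only
    rw [← Real.exp_add]; ring_nf
  obtain ⟨δ₁, hδ₁, n₁, h₁⟩ := measure_birkhoffSum_gt_le hQ hG hB hg hg0 ht₀ hge hη
  obtain ⟨δ₂, hδ₂, n₂, h₂⟩ := measure_birkhoffSum_gt_le hQ hG.neg hB hg.neg
    (by rw [integral_neg, hg0, neg_zero]) ht₀ hge' hη
  have hδ : 0 < min δ₁ δ₂ := lt_min hδ₁ hδ₂
  refine ⟨min δ₁ δ₂ / 2, by positivity,
    max (max n₁ n₂) ⌈Real.log 2 / (min δ₁ δ₂ / 2)⌉₊, fun n hn => ?_⟩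
  simp only [max_le_iff] at hn
  have hsub : {x | n * η < |birkhoffSum T f n x - n * c|} ⊆
      {x | n * η < birkhoffSum T (fun x => f x - c) n x} ∪
        {x | n * η < birkhoffSum T (fun x => -(f x - c)) n x} := by
    intro x hx
    have e1 : birkhoffSum T (fun x => f x - c) n x = birkhoffSum T f n x - n * c := by
      simp [birkhoffSum]
    have e2 : birkhoffSum T (fun x => -(f x - c)) n x = -(birkhoffSum T f n x - n * c) := by
      simp [birkhoffSum]
    simp only [mem_union, mem_ofPred_eq, e1, e2] at hx ⊢
    exact lt_abs.1 hx
  refine (measure_mono hsub).trans ((measure_union_le _ _).trans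
    ((add_le_add (h₁ n hn.1.1) (h₂ n hn.1.2)).trans ?_))
  rw [← ENNReal.ofReal_add (Real.exp_pos _).le (Real.exp_pos _).le]
  exact ENNReal.ofReal_le_ofReal (exp_neg_add_exp_neg_le hδ (min_le_left _ _) (min_le_right _ _)
    hn.2)

end Abstract

section Digits

lemma measurable_gaussMap : Measurable gaussMap := measurable_fract.comp measurable_inv

lemma measurable_cfDigit (i : ℕ) : Measurable (cfDigit i) :=
  (Nat.measurable_floor.comp measurable_inv).comp (measurable_gaussMap.iterate i)

lemma measurableSet_gaussSet : MeasurableSet gaussSet := by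
  have h : MeasurableSet {x : ℝ | Irrational x} :=
    (Set.countable_range ((↑) : ℚ → ℝ)).measurableSet.compl
  exact measurableSet_Icc.inter h

lemma pos_of_mem_gaussSet {x : ℝ} (hx : x ∈ gaussSet) : 0 < x :=
  lt_of_le_of_ne hx.1.1 fun h => hx.2 ⟨0, by simpa using h⟩

lemma lt_one_of_mem_gaussSet {x : ℝ} (hx : x ∈ gaussSet) : x < 1 :=
  lt_of_le_of_ne hx.1.2 fun h => hx.2 ⟨1, by simpa using h.symm⟩

lemma gaussMap_add_cfDigit1 {x : ℝ} (hx : x ∈ gaussSet) : gaussMap x + cfDigit1 x = x⁻¹ := by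
  have h : 0 ≤ x⁻¹ := (inv_pos.2 (pos_of_mem_gaussSet hx)).le
  rw [gaussMap, cfDigit1, natCast_floor_eq_intCast_floor h, Int.fract_add_floor]

lemma one_le_cfDigit1 {x : ℝ} (hx : x ∈ gaussSet) : 1 ≤ cfDigit1 x := by
  rw [cfDigit1, Nat.le_floor_iff' one_ne_zero, Nat.cast_one]
  exact (one_le_inv₀ (pos_of_mem_gaussSet hx)).2 hx.1.2

lemma gaussMap_mem {x : ℝ} (hx : x ∈ gaussSet) : gaussMap x ∈ gaussSet :=
  ⟨⟨Int.fract_nonneg _, (Int.fract_lt_one _).le⟩, by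
    have h : Irrational (x⁻¹ - ⌊x⁻¹⌋) := (irrational_inv_iff.2 hx.2).sub_intCast _
    exact h⟩

lemma gaussMap_iterate_mem {x : ℝ} (hx : x ∈ gaussSet) (k : ℕ) : gaussMap^[k] x ∈ gaussSet := by
  induction k with
  | zero => exact hx
  | succ k ih => rw [Function.iterate_succ_apply']; exact gaussMap_mem ih

lemma cfDigit_pos {x : ℝ} (hx : x ∈ gaussSet) (i : ℕ) : 0 < cfDigit i x :=
  one_le_cfDigit1 (gaussMap_iterate_mem hx i)

lemma invBranch1_cfDigit1 {x : ℝ} (hx : x ∈ gaussSet) :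
    invBranch1 (cfDigit1 x) (gaussMap x) = x := by
  rw [invBranch1, gaussMap_add_cfDigit1 hx, inv_inv]

lemma invBranch1_mem {a : ℕ} (ha : 0 < a) {x : ℝ} (hx : x ∈ gaussSet) :
    invBranch1 a x ∈ gaussSet := by
  have hx0 := pos_of_mem_gaussSet hx
  have ha' : (1 : ℝ) ≤ a := by exact_mod_cast ha
  refine ⟨⟨by unfold invBranch1; positivity, inv_le_one_of_one_le₀ (by linarith)⟩, ?_⟩
  exact irrational_inv_iff.2 (hx.2.add_natCast a)

lemma gaussMap_invBranch1 (a : ℕ) {x : ℝ} (hx : x ∈ gaussSet) :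
    gaussMap (invBranch1 a x) = x := by
  rw [gaussMap, invBranch1, inv_inv, Int.fract_add_natCast, Int.fract_eq_self]
  exact ⟨hx.1.1, lt_one_of_mem_gaussSet hx⟩

lemma cfDigit1_invBranch1 (a : ℕ) {x : ℝ} (hx : x ∈ gaussSet) :
    cfDigit1 (invBranch1 a x) = a := by
  rw [cfDigit1, invBranch1, inv_inv, Nat.floor_add_natCast hx.1.1,
    Nat.floor_eq_zero.2 (lt_one_of_mem_gaussSet hx), zero_add]

lemma mem_cylinder_iff {l : List ℕ} {x : ℝ} :
    x ∈ _root_.cylinder l ↔ x ∈ gaussSet ∧ ∀ (i : ℕ) (hi : i < l.length), cfDigit i x = l[i] := by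
  simp only [_root_.cylinder, Set.mem_ofPred_eq, Fin.forall_iff, List.get_eq_getElem]

lemma mem_cylinder_cons {a : ℕ} {l : List ℕ} {x : ℝ} :
    x ∈ _root_.cylinder (a :: l) ↔
      x ∈ gaussSet ∧ cfDigit1 x = a ∧ gaussMap x ∈ _root_.cylinder l := by
  rw [mem_cylinder_iff, mem_cylinder_iff]
  constructor
  · rintro ⟨hx, h⟩
    exact ⟨hx, h 0 (by simp), gaussMap_mem hx, fun i hi => h (i + 1) (by simpa using hi)⟩
  · rintro ⟨hx, h0, -, h⟩
    refine ⟨hx, fun i hi => ?_⟩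
    cases i with
    | zero => exact h0
    | succ i => exact h i (by simpa using hi)

lemma mem_cylinder_append {l l' : List ℕ} {x : ℝ} :
    x ∈ _root_.cylinder (l ++ l') ↔
      x ∈ _root_.cylinder l ∧ gaussMap^[l.length] x ∈ _root_.cylinder l' := by
  induction l generalizing x with
  | nil =>
    simp only [List.nil_append, List.length_nil, Function.iterate_zero, id]
    exact ⟨fun h => ⟨⟨h.1, fun i => i.elim0⟩, h⟩, fun h => h.2⟩
  | cons a l ih =>
    rw [List.cons_append, mem_cylinder_cons, mem_cylinder_cons, ih, List.length_cons,
      Function.iterate_succ_apply]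
    tauto

lemma invBranch_cons (a : ℕ) (l : List ℕ) (x : ℝ) :
    invBranch (a :: l) x = invBranch1 a (invBranch l x) := rfl

lemma invBranch_append (l l' : List ℕ) (x : ℝ) :
    invBranch (l ++ l') x = invBranch l (invBranch l' x) := by
  simp [invBranch]

lemma invBranch_mem_gaussSet {l : List ℕ} (hl : ∀ a ∈ l, 0 < a) {x : ℝ} (hx : x ∈ gaussSet) :
    invBranch l x ∈ gaussSet := by
  induction l with
  | nil => exact hx
  | cons a l ih =>
    rw [invBranch_cons]
    exact invBranch1_mem (hl a (by simp)) (ih fun b hb => hl b (by simp [hb]))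

lemma invBranch_mem_cylinder {l : List ℕ} (hl : ∀ a ∈ l, 0 < a) {x : ℝ} (hx : x ∈ gaussSet) :
    invBranch l x ∈ _root_.cylinder l := by
  induction l with
  | nil => exact ⟨hx, fun i => i.elim0⟩
  | cons a l ih =>
    have hl' : ∀ b ∈ l, 0 < b := fun b hb => hl b (by simp [hb])
    have hm := invBranch_mem_gaussSet hl' hx
    rw [invBranch_cons, mem_cylinder_cons, gaussMap_invBranch1 _ hm, cfDigit1_invBranch1 _ hm]
    exact ⟨invBranch1_mem (hl a (by simp)) hm, rfl, ih hl'⟩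

lemma gaussMap_iterate_invBranch {l : List ℕ} (hl : ∀ a ∈ l, 0 < a) {x : ℝ}
    (hx : x ∈ gaussSet) : gaussMap^[l.length] (invBranch l x) = x := by
  induction l with
  | nil => rfl
  | cons a l ih =>
    have hl' : ∀ b ∈ l, 0 < b := fun b hb => hl b (by simp [hb])
    rw [invBranch_cons, List.length_cons, Function.iterate_succ_apply,
      gaussMap_invBranch1 _ (invBranch_mem_gaussSet hl' hx), ih hl']

lemma invBranch_gaussMap_iterate {l : List ℕ} {x : ℝ} (hx : x ∈ _root_.cylinder l) :
    invBranch l (gaussMap^[l.length] x) = x := by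
  induction l generalizing x with
  | nil => rfl
  | cons a l ih =>
    obtain ⟨h1, h2, h3⟩ := mem_cylinder_cons.1 hx
    rw [List.length_cons, Function.iterate_succ_apply, invBranch_cons, ih h3, ← h2,
      invBranch1_cfDigit1 h1]

/-- The first `n` continued fraction digits. -/
noncomputable def digitWord (n : ℕ) (x : ℝ) : Fin n → ℕ := fun i => cfDigit i x

lemma measurable_digitWord (n : ℕ) : Measurable (digitWord n) :=
  measurable_pi_lambda _ fun i => measurable_cfDigit i

lemma mem_cylinder_ofFn {n : ℕ} {a : Fin n → ℕ} {x : ℝ} :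
    x ∈ _root_.cylinder (List.ofFn a) ↔ x ∈ gaussSet ∧ digitWord n x = a := by
  rw [mem_cylinder_iff, funext_iff, Fin.forall_iff]
  simp [digitWord]

lemma ofFn_digitWord_pos {x : ℝ} (hx : x ∈ gaussSet) (n : ℕ) :
    ∀ a ∈ List.ofFn (digitWord n x), 0 < a := by
  intro a ha
  obtain ⟨i, rfl⟩ := List.mem_ofFn.1 ha
  exact cfDigit_pos hx i

lemma mem_cylinder_digitWord {x : ℝ} (hx : x ∈ gaussSet) (n : ℕ) :
    x ∈ _root_.cylinder (List.ofFn (digitWord n x)) := mem_cylinder_ofFn.2 ⟨hx, rfl⟩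

lemma sqrt_two_sub_one_mem : √2 - 1 ∈ gaussSet := by
  refine ⟨⟨?_, ?_⟩, ?_⟩
  · rw [sub_nonneg, Real.one_le_sqrt]; norm_num
  · rw [sub_le_iff_le_add, Real.sqrt_le_left (by norm_num)]; norm_num
  · exact_mod_cast irrational_sqrt_two.sub_natCast 1

end Digits

section Distortion

/-- The total oscillation of `f` along orbit segments coded by the same word is at most `B`. -/
def SumDistortion (f : ℝ → ℝ) (B : ℝ) : Prop :=
  ∀ l : List ℕ, (∀ a ∈ l, 0 < a) → ∀ x ∈ _root_.cylinder l, ∀ y ∈ _root_.cylinder l,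
    ∑ k ∈ Finset.range l.length, |f (gaussMap^[k] x) - f (gaussMap^[k] y)| ≤ B

lemma LocHolder.sumDistortion {f : ℝ → ℝ} (hf : LocHolder f) : ∃ B, SumDistortion f B := by
  obtain ⟨C, hC, θ, hθ, h⟩ := hf
  have key : ∀ l : List ℕ, (∀ a ∈ l, 0 < a) → ∀ x ∈ _root_.cylinder l,
      ∀ y ∈ _root_.cylinder l, ∑ k ∈ Finset.range l.length,
        |f (gaussMap^[k] x) - f (gaussMap^[k] y)| ≤
          ∑ k ∈ Finset.range l.length, C * θ ^ (k + 1) := by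
    intro l
    induction l with
    | nil => simp
    | cons a l ih =>
      intro hl x hx y hy
      rw [List.length_cons, Finset.sum_range_succ', Finset.sum_range_succ]
      refine add_le_add (ih (fun b hb => hl b (by simp [hb])) _ (mem_cylinder_cons.1 hx).2.2 _
        (mem_cylinder_cons.1 hy).2.2) ?_
      simpa using h (a :: l) (by simp) hl x hx y hy
  refine ⟨∑' k : ℕ, C * θ ^ (k + 1), fun l hl x hx y hy => (key l hl x hx y hy).trans ?_⟩
  have hs : Summable fun k : ℕ => C * θ ^ (k + 1) :=
    ((summable_nat_add_iff 1).2 (summable_geometric_of_lt_one hθ.1.le hθ.2)).mul_left C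
  exact hs.sum_le_tsum _ fun k _ => by have := hθ.1; positivity

lemma SumDistortion.nonneg {f : ℝ → ℝ} {B : ℝ} (h : SumDistortion f B) : 0 ≤ B := by
  have hx : √2 - 1 ∈ _root_.cylinder [] := ⟨sqrt_two_sub_one_mem, fun i => i.elim0⟩
  simpa using h [] (by simp) _ hx _ hx

lemma SumDistortion.sub_mul {f g : ℝ → ℝ} {B B' : ℝ} (hf : SumDistortion f B)
    (hg : SumDistortion g B') (s : ℝ) : SumDistortion (fun x => f x - s * g x) (B + |s| * B') := by
  intro l hl x hx y hy
  refine le_trans ?_ (add_le_add (hf l hl x hx y hy)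
    (mul_le_mul_of_nonneg_left (hg l hl x hx y hy) (abs_nonneg s)))
  rw [Finset.mul_sum, ← Finset.sum_add_distrib]
  refine Finset.sum_le_sum fun k _ => ?_
  rw [← abs_mul, sub_sub_sub_comm, ← mul_sub]
  exact abs_sub _ _

lemma SumDistortion.min_neg {f : ℝ → ℝ} {B : ℝ} (hf : SumDistortion f B) (M : ℝ) :
    SumDistortion (fun x => min (-f x) M) B := by
  intro l hl x hx y hy
  refine le_trans (Finset.sum_le_sum fun k _ => ?_) (hf l hl x hx y hy)
  refine (abs_min_sub_min_le_max _ _ _ _).trans (le_of_eq ?_)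
  rw [sub_self, abs_zero, max_eq_left (abs_nonneg _), neg_sub_neg, abs_sub_comm]

lemma SumDistortion.codedBy {f : ℝ → ℝ} {B : ℝ} (hf : SumDistortion f B) {μ : Measure ℝ}
    (hμ : ∀ᵐ x ∂μ, x ∈ gaussSet) :
    CodedBy μ gaussMap digitWord f
      (fun n a => birkhoffSum gaussMap f n (invBranch (List.ofFn a) (√2 - 1))) B := by
  intro n _
  filter_upwards [hμ] with x hx
  have hp := ofFn_digitWord_pos hx n
  have h := hf _ hp x (mem_cylinder_digitWord hx n) _
    (invBranch_mem_cylinder hp sqrt_two_sub_one_mem)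
  rw [List.length_ofFn] at h
  refine le_trans ?_ h
  rw [birkhoffSum, birkhoffSum, ← Finset.sum_sub_distrib]
  exact Finset.abs_sum_le_sum_abs _ _

lemma LocHolder.aemeasurable {f : ℝ → ℝ} (hf : LocHolder f) {μ : Measure ℝ}
    (hμ : ∀ᵐ x ∂μ, x ∈ gaussSet) : AEMeasurable f μ := by
  obtain ⟨C, hC, θ, hθ, h⟩ := hf
  refine aemeasurable_of_tendsto_metrizable_ae'
    (f := fun n x => f (invBranch (List.ofFn (digitWord (n + 1) x)) (√2 - 1))) (fun n => ?_) ?_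
  · exact ((measurable_of_countable fun a : Fin (n + 1) → ℕ =>
      f (invBranch (List.ofFn a) (√2 - 1))).comp (measurable_digitWord (n + 1))).aemeasurable
  · filter_upwards [hμ] with x hx
    rw [tendsto_iff_dist_tendsto_zero]
    have hlim : Tendsto (fun n : ℕ => C * θ ^ (n + 1)) atTop (𝓝 (C * 0)) :=
      ((tendsto_add_atTop_iff_nat 1).2
        (tendsto_pow_atTop_nhds_zero_of_lt_one hθ.1.le hθ.2)).const_mul C
    rw [mul_zero] at hlim
    refine squeeze_zero (fun _ => dist_nonneg) (fun n => ?_) hlim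
    have hp := ofFn_digitWord_pos hx (n + 1)
    have := h _ (by simp) hp _ (invBranch_mem_cylinder hp sqrt_two_sub_one_mem) x
      (mem_cylinder_digitWord hx (n + 1))
    rwa [List.length_ofFn] at this

end Distortion

section Psi

lemma gaussPsi_eq (x : ℝ) : gaussPsi x = 2 * Real.log x := by
  simp [gaussPsi]

lemma logAbsDerivGauss_eq (x : ℝ) : logAbsDerivGauss x = -gaussPsi x := by
  simp [gaussPsi, logAbsDerivGauss]

lemma measurable_gaussPsi : Measurable gaussPsi := by
  unfold gaussPsi
  fun_prop

lemma gaussPsi_neg {x : ℝ} (hx : x ∈ gaussSet) : gaussPsi x < 0 := by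
  rw [gaussPsi_eq]
  have := Real.log_neg (pos_of_mem_gaussSet hx) (lt_one_of_mem_gaussSet hx)
  linarith

lemma mul_gaussMap_le {x : ℝ} (hx : x ∈ gaussSet) : x * gaussMap x ≤ 1 / 2 := by
  have hx0 := pos_of_mem_gaussSet hx
  have h1 : x * (gaussMap x + cfDigit1 x) = 1 := by
    rw [gaussMap_add_cfDigit1 hx, mul_inv_cancel₀ hx0.ne']
  have h2 : (1 : ℝ) ≤ cfDigit1 x := by exact_mod_cast one_le_cfDigit1 hx
  have h3 := lt_one_of_mem_gaussSet (gaussMap_mem hx)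
  have h4 : x * gaussMap x ≤ x * cfDigit1 x := by gcongr; linarith
  linarith

lemma sub_eq_mul_gaussMap_sub {a : ℕ} {l : List ℕ} {x y : ℝ} (hx : x ∈ _root_.cylinder (a :: l))
    (hy : y ∈ _root_.cylinder (a :: l)) : x - y = x * y * (gaussMap y - gaussMap x) := by
  obtain ⟨hx1, hx2, -⟩ := mem_cylinder_cons.1 hx
  obtain ⟨hy1, hy2, -⟩ := mem_cylinder_cons.1 hy
  have ex := gaussMap_add_cfDigit1 hx1
  have ey := gaussMap_add_cfDigit1 hy1
  have hx0 := (pos_of_mem_gaussSet hx1).ne'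
  have hy0 := (pos_of_mem_gaussSet hy1).ne'
  rw [hx2] at ex
  rw [hy2] at ey
  rw [eq_sub_of_add_eq ex, eq_sub_of_add_eq ey]
  field_simp
  ring

lemma abs_sub_le_of_mem_cylinder : ∀ (l : List ℕ) {x y : ℝ}, x ∈ _root_.cylinder l →
    y ∈ _root_.cylinder l → |x - y| ≤ 2 * (1 / 2) ^ l.length
  | [], x, y, hx, hy => by
    have := pos_of_mem_gaussSet hx.1
    have := pos_of_mem_gaussSet hy.1
    have := lt_one_of_mem_gaussSet hx.1
    have := lt_one_of_mem_gaussSet hy.1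
    rw [abs_le]
    constructor <;> norm_num <;> linarith
  | [a], x, y, hx, hy => by
    have := pos_of_mem_gaussSet hx.1
    have := pos_of_mem_gaussSet hy.1
    have := lt_one_of_mem_gaussSet hx.1
    have := lt_one_of_mem_gaussSet hy.1
    rw [abs_le]
    constructor <;> norm_num <;> linarith
  | a :: b :: l, x, y, hx, hy => by
    have hx' := (mem_cylinder_cons.1 hx).2.2
    have hy' := (mem_cylinder_cons.1 hy).2.2
    have ih := abs_sub_le_of_mem_cylinder l (mem_cylinder_cons.1 hx').2.2
      (mem_cylinder_cons.1 hy').2.2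
    have hx0 := pos_of_mem_gaussSet hx.1
    have hy0 := pos_of_mem_gaussSet hy.1
    have hx0' := pos_of_mem_gaussSet hx'.1
    have hy0' := pos_of_mem_gaussSet hy'.1
    have e : x - y = (x * gaussMap x) * (y * gaussMap y) *
        (gaussMap (gaussMap x) - gaussMap (gaussMap y)) := by
      have h1 := sub_eq_mul_gaussMap_sub hx hy
      have h2 := sub_eq_mul_gaussMap_sub hy' hx'
      rw [h1, h2]; ring
    rw [e]
    simp only [abs_mul, abs_of_pos hx0, abs_of_pos hy0,
      abs_of_pos hx0', abs_of_pos hy0']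
    calc x * gaussMap x * (y * gaussMap y) * |gaussMap (gaussMap x) - gaussMap (gaussMap y)|
        ≤ 1 / 2 * (1 / 2) * (2 * (1 / 2) ^ l.length) := by
          gcongr
          · exact mul_gaussMap_le hx.1
          · exact mul_gaussMap_le hy.1
      _ = 2 * (1 / 2) ^ (a :: b :: l).length := by
          simp only [List.length_cons]; ring

lemma log_sub_log_le_of_mem_cylinder {a : ℕ} {l : List ℕ} {x y : ℝ}
    (hx : x ∈ _root_.cylinder (a :: l)) (hy : y ∈ _root_.cylinder (a :: l)) :
    Real.log x - Real.log y ≤ |gaussMap x - gaussMap y| := by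
  have hx0 := pos_of_mem_gaussSet hx.1
  have hy0 := pos_of_mem_gaussSet hy.1
  have h := sub_eq_mul_gaussMap_sub hx hy
  rw [← Real.log_div hx0.ne' hy0.ne']
  refine (Real.log_le_sub_one_of_pos (by positivity)).trans ?_
  have e : x / y - 1 = x * (gaussMap y - gaussMap x) := by
    rw [div_sub_one hy0.ne', h]; field_simp
  rw [e]
  calc x * (gaussMap y - gaussMap x) ≤ x * |gaussMap x - gaussMap y| := by
        gcongr
        rw [abs_sub_comm]
        exact le_abs_self _
    _ ≤ 1 * |gaussMap x - gaussMap y| := by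
        gcongr
        exact hx.1.1.2
    _ = _ := one_mul _

lemma locHolder_gaussPsi : LocHolder gaussPsi := by
  refine ⟨8, by norm_num, 1 / 2, by norm_num, fun l hl hpos x hx y hy => ?_⟩
  obtain ⟨a, l, rfl⟩ := List.exists_cons_of_ne_nil hl
  have h1 := log_sub_log_le_of_mem_cylinder hx hy
  have h2 := log_sub_log_le_of_mem_cylinder hy hx
  have h3 := abs_sub_le_of_mem_cylinder l (mem_cylinder_cons.1 hx).2.2 (mem_cylinder_cons.1 hy).2.2
  rw [abs_sub_comm] at h2
  have h4 : |Real.log x - Real.log y| ≤ 2 * (1 / 2) ^ l.length :=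
    (abs_le.2 ⟨by linarith, h1⟩).trans h3
  rw [gaussPsi_eq, gaussPsi_eq, ← mul_sub, abs_mul, abs_two, List.length_cons, pow_succ]
  linarith

lemma birkhoff_gaussPsi_le {x : ℝ} (hx : x ∈ gaussSet) : ∀ n : ℕ,
    birkhoff gaussPsi n x ≤ -((n - 1) * Real.log 2)
  | 0 => by
    have : 0 ≤ Real.log 2 := Real.log_nonneg (by norm_num)
    simpa [birkhoff] using this
  | 1 => by simpa [birkhoff] using (gaussPsi_neg hx).le
  | n + 2 => by
    have ih := birkhoff_gaussPsi_le hx n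
    have hy := gaussMap_iterate_mem hx n
    have hy0 := pos_of_mem_gaussSet hy
    have hy1 := pos_of_mem_gaussSet (gaussMap_mem hy)
    have h1 : Real.log (gaussMap^[n] x) + Real.log (gaussMap (gaussMap^[n] x)) ≤ -Real.log 2 := by
      rw [← Real.log_mul hy0.ne' hy1.ne', ← Real.log_inv]
      refine Real.log_le_log (by positivity) ?_
      simpa using mul_gaussMap_le hy
    unfold birkhoff at ih ⊢
    rw [Finset.sum_range_succ, Finset.sum_range_succ, Function.iterate_succ_apply',
      gaussPsi_eq (gaussMap^[n] x), gaussPsi_eq (gaussMap (gaussMap^[n] x))]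
    push_cast
    linarith

end Psi

section Gibbs

variable {φ : ℝ → ℝ} {μ : Measure ℝ}

lemma ae_mem_gaussSet [IsProbabilityMeasure μ] (hμ : μ gaussSet = 1) :
    ∀ᵐ x ∂μ, x ∈ gaussSet :=
  (prob_compl_eq_zero_iff measurableSet_gaussSet).2 hμ

lemma GaussInvariant.measurePreserving (h : GaussInvariant μ) : MeasurePreserving gaussMap μ μ :=
  ⟨measurable_gaussMap, Measure.ext fun s hs => by
    rw [Measure.map_apply measurable_gaussMap hs, h s hs]⟩

lemma measure_le_smul_of_singleton {β : Type*} [MeasurableSpace β] [Countable β]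
    [MeasurableSingletonClass β] {ν ρ : Measure β} {K : ℝ≥0}
    (h : ∀ b, ν {b} ≤ K * ρ {b}) : ν ≤ K • ρ := by
  refine Measure.le_iff.2 fun s hs => ?_
  rw [← Measure.tsum_indicator_apply_singleton ν s hs,
    ← Measure.tsum_indicator_apply_singleton (K • ρ) s hs]
  refine ENNReal.tsum_le_tsum fun b => ?_
  by_cases hb : b ∈ s
  · simp only [hb, Set.indicator_of_mem]
    exact h b
  · simp [hb]

lemma gibbs_const_bounds (hG : IsGibbs φ μ) : ∃ C : ℝ, 1 ≤ C ∧
    ∀ l m : List ℕ, l ≠ [] → m ≠ [] → (∀ a ∈ l, 0 < a) → (∀ a ∈ m, 0 < a) →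
      (μ (_root_.cylinder (l ++ m))).toReal ≤
          C * ((μ (_root_.cylinder l)).toReal * (μ (_root_.cylinder m)).toReal) ∧
        (μ (_root_.cylinder l)).toReal * (μ (_root_.cylinder m)).toReal ≤
          C * (μ (_root_.cylinder (l ++ m))).toReal := by
  obtain ⟨C, hC, h⟩ := hG
  have hC0 : 0 < C := by linarith
  refine ⟨C * (C * C), ?_, fun l m hl hm hlp hmp => ?_⟩
  · nlinarith
  have hx := sqrt_two_sub_one_mem
  have hy := invBranch_mem_gaussSet hmp hx
  obtain ⟨l1, l2⟩ := h l hl hlp _ hy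
  obtain ⟨m1, m2⟩ := h m hm hmp _ hx
  obtain ⟨a1, a2⟩ := h (l ++ m) (by simp [hl])
    (fun a ha => (List.mem_append.1 ha).elim (hlp a) (hmp a)) _ hx
  have e : birkhoff φ (l ++ m).length (invBranch (l ++ m) (√2 - 1)) =
      birkhoff φ l.length (invBranch l (invBranch m (√2 - 1))) +
        birkhoff φ m.length (invBranch m (√2 - 1)) := by
    rw [List.length_append, invBranch_append]
    have := birkhoffSum_add gaussMap φ l.length m.length (invBranch l (invBranch m (√2 - 1)))
    rw [gaussMap_iterate_invBranch hlp hy] at this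
    exact this
  rw [e, Real.exp_add] at a1 a2
  set p := Real.exp (birkhoff φ l.length (invBranch l (invBranch m (√2 - 1))))
  set q := Real.exp (birkhoff φ m.length (invBranch m (√2 - 1)))
  have hp : 0 < p := Real.exp_pos _
  have hq : 0 < q := Real.exp_pos _
  have hl1 : p ≤ C * (μ (_root_.cylinder l)).toReal := by
    rwa [inv_mul_le_iff₀ hC0] at l1
  have hm1 : q ≤ C * (μ (_root_.cylinder m)).toReal := by
    rwa [inv_mul_le_iff₀ hC0] at m1
  have ha1 : p * q ≤ C * (μ (_root_.cylinder (l ++ m))).toReal := by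
    rwa [inv_mul_le_iff₀ hC0] at a1
  constructor
  · calc _ ≤ C * (p * q) := a2
      _ ≤ C * ((C * (μ (_root_.cylinder l)).toReal) * (C * (μ (_root_.cylinder m)).toReal)) := by
        gcongr
      _ = _ := by ring
  · calc _ ≤ (C * p) * (C * q) := by gcongr
      _ = C * C * (p * q) := by ring
      _ ≤ C * C * (C * (μ (_root_.cylinder (l ++ m))).toReal) := by gcongr
      _ = _ := by ring

lemma map_digitWord_singleton [IsProbabilityMeasure μ] (hμ : μ gaussSet = 1) {n : ℕ}
    (a : Fin n → ℕ) : μ.map (digitWord n) {a} = μ (_root_.cylinder (List.ofFn a)) := by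
  rw [Measure.map_apply (measurable_digitWord n) (measurableSet_singleton a)]
  refine measure_congr ?_
  filter_upwards [ae_mem_gaussSet hμ] with x hx
  refine propext ?_
  change digitWord n x = a ↔ x ∈ _root_.cylinder (List.ofFn a)
  rw [mem_cylinder_ofFn]
  tauto

lemma map_digitWord_pair_singleton [IsProbabilityMeasure μ] (hμ : μ gaussSet = 1) {n m : ℕ}
    (a : Fin n → ℕ) (b : Fin m → ℕ) :
    μ.map (fun x => (digitWord n x, digitWord m (gaussMap^[n] x))) {(a, b)} =
      μ (_root_.cylinder (List.ofFn a ++ List.ofFn b)) := by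
  have hmeas : Measurable fun x => (digitWord n x, digitWord m (gaussMap^[n] x)) :=
    (measurable_digitWord n).prodMk ((measurable_digitWord m).comp (measurable_gaussMap.iterate n))
  rw [Measure.map_apply hmeas (measurableSet_singleton _)]
  refine measure_congr ?_
  filter_upwards [ae_mem_gaussSet hμ] with x hx
  refine propext ?_
  change (digitWord n x, digitWord m (gaussMap^[n] x)) = (a, b) ↔
    x ∈ _root_.cylinder (List.ofFn a ++ List.ofFn b)
  rw [mem_cylinder_append, mem_cylinder_ofFn, List.length_ofFn, mem_cylinder_ofFn, Prod.mk.injEq]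
  have := gaussMap_iterate_mem hx n
  tauto

lemma cylinder_eq_empty_of_not_pos {l : List ℕ} (hl : ¬ ∀ a ∈ l, 0 < a) :
    _root_.cylinder l = ∅ := by
  refine Set.eq_empty_of_forall_notMem fun x hx => hl fun a ha => ?_
  obtain ⟨i, hi, rfl⟩ := List.mem_iff_getElem.1 ha
  have h := mem_cylinder_iff.1 hx
  rw [← h.2 i hi]
  exact cfDigit_pos h.1 i

lemma exists_quasiBernoulli [IsProbabilityMeasure μ] (hμ : μ gaussSet = 1)
    (hinv : GaussInvariant μ) (hG : IsGibbs φ μ) :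
    ∃ K, QuasiBernoulli μ gaussMap digitWord K := by
  obtain ⟨C, hC, h⟩ := gibbs_const_bounds hG
  have hC0 : 0 ≤ C := by linarith
  have hco : ((Real.toNNReal C : ℝ≥0) : ℝ≥0∞) = ENNReal.ofReal C := rfl
  have hprod : ∀ {n m : ℕ} (a : Fin n → ℕ) (b : Fin m → ℕ),
      ((μ.map (digitWord n)).prod (μ.map (digitWord m))) {(a, b)} =
        μ (_root_.cylinder (List.ofFn a)) * μ (_root_.cylinder (List.ofFn b)) := by
    intro n m a b
    rw [← Set.singleton_prod_singleton, Measure.prod_prod, map_digitWord_singleton hμ,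
      map_digitWord_singleton hμ]
  refine ⟨Real.toNNReal C, hinv.measurePreserving, measurable_digitWord, by simpa using hC,
    fun n m hn hm => measure_le_smul_of_singleton ?_, fun n m hn hm =>
      measure_le_smul_of_singleton ?_⟩
  all_goals
    rintro ⟨a, b⟩
    rw [map_digitWord_pair_singleton hμ, hprod, hco]
    have ha : List.ofFn a ≠ [] := by simp; lia
    have hb : List.ofFn b ≠ [] := by simp; lia
    by_cases hp : ∀ c ∈ List.ofFn a ++ List.ofFn b, 0 < c
    · have := h _ _ ha hb (fun c hc => hp c (by simp only [List.mem_append, hc, true_or]))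
        (fun c hc => hp c (by simp only [List.mem_append, hc, or_true]))
      rw [← ENNReal.toReal_le_toReal (by finiteness) (by finiteness)]
      simpa only [ENNReal.toReal_mul, ENNReal.toReal_ofReal hC0] using (by tauto)
    · rw [cylinder_eq_empty_of_not_pos hp]
      by_cases hp1 : ∀ c ∈ List.ofFn a, 0 < c
      · have hp2 : ¬ ∀ c ∈ List.ofFn b, 0 < c := fun hp2 => hp fun c hc =>
          (List.mem_append.1 hc).elim (hp1 c) (hp2 c)
        simp [cylinder_eq_empty_of_not_pos hp2]
      · simp [cylinder_eq_empty_of_not_pos hp1]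

end Gibbs

section ExponentialMoments

/-- The positive fixed point of the inverse branch `x ↦ 1 / (x + a)`. -/
noncomputable def branchFixedPoint (a : ℕ) : ℝ := (-a + √((a ^ 2 + 4 : ℕ) : ℝ)) / 2

lemma branchFixedPoint_mul (a : ℕ) : branchFixedPoint a * (branchFixedPoint a + a) = 1 := by
  have h : √((a ^ 2 + 4 : ℕ) : ℝ) ^ 2 = (a : ℝ) ^ 2 + 4 := by
    rw [Real.sq_sqrt (by positivity)]; push_cast; ring
  unfold branchFixedPoint
  linear_combination h / 4

lemma branchFixedPoint_pos (a : ℕ) : 0 < branchFixedPoint a := by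
  have h : (a : ℝ) < √((a ^ 2 + 4 : ℕ) : ℝ) := by
    apply Real.lt_sqrt_of_sq_lt
    push_cast
    linarith
  unfold branchFixedPoint
  linarith

lemma branchFixedPoint_lt_one {a : ℕ} (ha : 0 < a) : branchFixedPoint a < 1 := by
  have h1 := branchFixedPoint_mul a
  have h2 := branchFixedPoint_pos a
  have h3 : (1 : ℝ) ≤ a := by exact_mod_cast ha
  nlinarith

lemma not_isSquare_sq_add_four {a : ℕ} (ha : 0 < a) : ¬ IsSquare (a ^ 2 + 4) := by
  rintro ⟨k, hk⟩
  rcases lt_trichotomy k (a + 1) with h | h | h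
  · nlinarith
  · subst h
    ring_nf at hk
    lia
  · nlinarith

lemma branchFixedPoint_mem {a : ℕ} (ha : 0 < a) : branchFixedPoint a ∈ gaussSet := by
  refine ⟨⟨(branchFixedPoint_pos a).le, (branchFixedPoint_lt_one ha).le⟩, ?_⟩
  have h : Irrational √((a ^ 2 + 4 : ℕ) : ℝ) :=
    irrational_sqrt_natCast_iff.2 (not_isSquare_sq_add_four ha)
  have h3 : Irrational (((-a : ℤ) : ℝ) + √((a ^ 2 + 4 : ℕ) : ℝ)) := h.intCast_add _
  unfold branchFixedPoint
  have h4 := h3.div_natCast (m := 2) two_ne_zero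
  push_cast at h4 ⊢
  exact h4

lemma invBranch1_branchFixedPoint (a : ℕ) :
    invBranch1 a (branchFixedPoint a) = branchFixedPoint a :=
  (eq_inv_of_mul_eq_one_left (branchFixedPoint_mul a)).symm

lemma periodicPoint_singleton {a : ℕ} (ha : 0 < a) :
    periodicPoint [a] = branchFixedPoint a := by
  set p := branchFixedPoint a with hp
  have ha1 : (1 : ℝ) ≤ a := by exact_mod_cast ha
  have hp0 : 0 < p := branchFixedPoint_pos a
  have key : ∀ k : ℕ, 0 ≤ invBranch (List.flatten (List.replicate k [a])) (1 / 2 : ℝ) ∧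
      |invBranch (List.flatten (List.replicate k [a])) (1 / 2 : ℝ) - p| ≤
        p ^ k * |1 / 2 - p| := by
    intro k
    induction k with
    | zero => simp [invBranch]
    | succ k ih =>
      rw [List.replicate_succ, List.flatten_cons, List.singleton_append, invBranch_cons]
      obtain ⟨h0, h1⟩ := ih
      set y := invBranch (List.flatten (List.replicate k [a])) (1 / 2 : ℝ)
      refine ⟨by unfold invBranch1; positivity, ?_⟩
      have hya : 1 ≤ y + a := by linarith
      have e : invBranch1 a y - p = -(p * (y - p)) * (y + a)⁻¹ := by
        have := branchFixedPoint_mul a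
        rw [← hp] at this
        have h' : y + a ≠ 0 := by positivity
        rw [invBranch1]
        field_simp
        linear_combination -this
      rw [e, abs_mul, abs_neg, abs_mul, abs_of_pos hp0, abs_of_pos (a := (y + a)⁻¹) (by positivity)]
      calc p * |y - p| * (y + a)⁻¹ ≤ p * |y - p| * 1 := by
            gcongr
            exact inv_le_one_of_one_le₀ hya
        _ ≤ p * (p ^ k * |1 / 2 - p|) * 1 := by gcongr
        _ = p ^ (k + 1) * |1 / 2 - p| := by ring
  refine Tendsto.limUnder_eq ?_
  rw [tendsto_iff_dist_tendsto_zero]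
  have hlim : Tendsto (fun k : ℕ => p ^ k * |1 / 2 - p|) atTop (𝓝 (0 * |1 / 2 - p|)) :=
    (tendsto_pow_atTop_nhds_zero_of_lt_one hp0.le (branchFixedPoint_lt_one ha)).mul_const _
  rw [zero_mul] at hlim
  exact squeeze_zero (fun _ => dist_nonneg) (fun k => (key k).2) hlim

variable {φ f : ℝ → ℝ} {μ : Measure ℝ}

lemma tsum_exp_branchFixedPoint_le (F : ℝ → ℝ) :
    ∑' b : ℕ, ENNReal.ofReal (Real.exp (F (branchFixedPoint (b + 1)))) ≤ partSum F 1 := by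
  let e : ℕ → Word 1 := fun b => ⟨[b + 1], by simp⟩
  have he : Function.Injective e := fun b c h => by
    have := congrArg Subtype.val h
    simpa [e] using this
  refine le_trans (le_of_eq ?_) (ENNReal.tsum_comp_le_tsum_of_injective he
    fun l : Word 1 => ENNReal.ofReal (Real.exp (birkhoff F 1 (periodicPoint l.1))))
  refine tsum_congr fun b => ?_
  simp [e, birkhoff, periodicPoint_singleton]

lemma integrable_exp_mul_of_pressureFinite [IsProbabilityMeasure μ] (hμ : μ gaussSet = 1)
    (hG : IsGibbs φ μ) (hf : AEMeasurable f μ) {B : ℝ} (hB : SumDistortion f B) {t : ℝ}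
    (hp : PressureFinite fun x => t * f x + φ x) :
    Integrable (fun x => Real.exp (t * f x)) μ := by
  obtain ⟨p, hp, -⟩ := hp
  obtain ⟨C, hC, hG⟩ := hG
  have hC0 : 0 ≤ C := by linarith
  refine ⟨(Real.measurable_exp.comp_aemeasurable (hf.const_mul t)).aestronglyMeasurable, ?_⟩
  rw [hasFiniteIntegral_iff_ofReal (ae_of_all _ fun x => (Real.exp_pos _).le)]
  set G : ℕ → ℝ≥0∞ := fun a => ENNReal.ofReal (Real.exp (t * f (branchFixedPoint a) + |t| * B))
  have hd : Measurable cfDigit1 := measurable_cfDigit 0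
  have hmass0 : μ.map cfDigit1 {0} = 0 := by
    rw [Measure.map_apply hd (measurableSet_singleton 0)]
    refine measure_eq_zero_iff_ae_notMem.2 ?_
    filter_upwards [ae_mem_gaussSet hμ] with x hx
    exact Nat.one_le_iff_ne_zero.1 (one_le_cfDigit1 hx)
  have hmass : ∀ b : ℕ, μ.map cfDigit1 {b + 1} ≤
      ENNReal.ofReal (C * Real.exp (φ (branchFixedPoint (b + 1)))) := by
    intro b
    have h := (hG [b + 1] (by simp) (by simp) _ (branchFixedPoint_mem b.succ_pos)).2
    rw [invBranch_cons] at h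
    simp only [invBranch, List.foldr_nil, invBranch1_branchFixedPoint] at h
    rw [Measure.map_apply hd (measurableSet_singleton _)]
    have e : cfDigit1 ⁻¹' {b + 1} =ᵐ[μ] _root_.cylinder [b + 1] := by
      filter_upwards [ae_mem_gaussSet hμ] with x hx
      refine propext ?_
      change cfDigit1 x = b + 1 ↔ x ∈ _root_.cylinder [b + 1]
      simp [mem_cylinder_iff, hx, cfDigit]
    rw [measure_congr e, ENNReal.le_ofReal_iff_toReal_le (by finiteness) (by positivity)]
    simpa [birkhoff] using h
  calc ∫⁻ x, ENNReal.ofReal (Real.exp (t * f x)) ∂μ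
      ≤ ∫⁻ x, G (cfDigit1 x) ∂μ := by
        refine lintegral_mono_ae ?_
        filter_upwards [ae_mem_gaussSet hμ] with x hx
        have hpos : 0 < cfDigit1 x := one_le_cfDigit1 hx
        refine ENNReal.ofReal_le_ofReal (Real.exp_le_exp.2 ?_)
        have hc : branchFixedPoint (cfDigit1 x) ∈ _root_.cylinder [cfDigit1 x] := by
          have := invBranch_mem_cylinder (l := [cfDigit1 x]) (by simpa using hpos)
            (branchFixedPoint_mem hpos)
          rwa [show invBranch [cfDigit1 x] (branchFixedPoint (cfDigit1 x)) =
            branchFixedPoint (cfDigit1 x) from invBranch1_branchFixedPoint _] at this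
        have h := hB [cfDigit1 x] (by simpa using hpos) x
          (by simp [mem_cylinder_iff, hx, cfDigit]) _ hc
        simp only [List.length_singleton, Finset.range_one, Finset.sum_singleton,
          Function.iterate_zero, id] at h
        have h2 : t * (f x - f (branchFixedPoint (cfDigit1 x))) ≤ |t| * B := by
          refine (le_abs_self _).trans ?_
          rw [abs_mul]
          gcongr
        linarith
    _ = ∫⁻ a, G a ∂(μ.map cfDigit1) := (lintegral_map (measurable_of_countable G) hd).symm
    _ = ∑' a : ℕ, G a * μ.map cfDigit1 {a} := lintegral_countable' G
    _ = ∑' b : ℕ, G (b + 1) * μ.map cfDigit1 {b + 1} := by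
        rw [tsum_eq_zero_add' ENNReal.summable, hmass0, mul_zero, zero_add]
    _ ≤ ∑' b : ℕ, ENNReal.ofReal (Real.exp (|t| * B) * C) *
          ENNReal.ofReal (Real.exp (t * f (branchFixedPoint (b + 1)) +
            φ (branchFixedPoint (b + 1)))) := by
        refine ENNReal.tsum_le_tsum fun b => (mul_le_mul_right (hmass b) _).trans (le_of_eq ?_)
        rw [← ENNReal.ofReal_mul (by positivity), ← ENNReal.ofReal_mul (by positivity),
          Real.exp_add, Real.exp_add]
        congr 1
        ring
    _ ≤ ENNReal.ofReal (Real.exp (|t| * B) * C) * partSum (fun x => t * f x + φ x) 1 := by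
        rw [ENNReal.tsum_mul_left]
        gcongr
        exact tsum_exp_branchFixedPoint_le fun x => t * f x + φ x
    _ < ⊤ := ENNReal.mul_lt_top ENNReal.ofReal_lt_top (hp 1 one_pos).lt_top

end ExponentialMoments

section Entropy

variable {φ : ℝ → ℝ} {μ : Measure ℝ}

lemma IsGibbs.abs_log_cylinder_sub_le (hG : IsGibbs φ μ) : ∃ C : ℝ, 0 ≤ C ∧ ∀ n : ℕ, 1 ≤ n →
    ∀ x ∈ gaussSet, |Real.log (μ (_root_.cylinder (List.ofFn (digitWord n x)))).toReal -
      birkhoffSum gaussMap φ n x| ≤ C := by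
  obtain ⟨C, hC, h⟩ := hG
  have hC0 : 0 < C := by linarith
  refine ⟨Real.log C, Real.log_nonneg hC, fun n hn x hx => ?_⟩
  have hne : List.ofFn (digitWord n x) ≠ [] := by simp; lia
  obtain ⟨h1, h2⟩ := h _ hne (ofFn_digitWord_pos hx n) _
    (gaussMap_iterate_mem hx (List.ofFn (digitWord n x)).length)
  rw [invBranch_gaussMap_iterate (mem_cylinder_digitWord hx n), List.length_ofFn] at h1 h2
  set m := (μ (_root_.cylinder (List.ofFn (digitWord n x)))).toReal
  have hm : 0 < m := lt_of_lt_of_le (by positivity) h1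
  have g1 := Real.log_le_log (by positivity) h1
  have g2 := Real.log_le_log hm h2
  rw [Real.log_mul (by positivity) (Real.exp_pos _).ne', Real.log_exp] at g1 g2
  rw [Real.log_inv] at g1
  change |Real.log m - birkhoff φ n x| ≤ _
  rw [abs_le]
  constructor <;> linarith

lemma tsum_word_eq_tsum_fin {n : ℕ} {F : List ℕ → ℝ}
    (hF : ∀ l : List ℕ, (¬ ∀ a ∈ l, 0 < a) → F l = 0) :
    ∑' l : Word n, F l.1 = ∑' a : Fin n → ℕ, F (List.ofFn a) := by
  let e : Word n → (Fin n → ℕ) := fun l i => l.1.get (i.cast l.2.1.symm)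
  have he : ∀ l, List.ofFn (e l) = l.1 := by
    rintro ⟨l, rfl, hl⟩
    exact List.ofFn_get l
  have hinj : Function.Injective e := fun l l' h => Subtype.ext (by rw [← he l, h, he l'])
  rw [← hinj.tsum_eq (f := fun a => F (List.ofFn a))]
  · simp only [he]
  · intro a ha
    by_contra hr
    refine ha (hF _ fun hp => hr ⟨⟨List.ofFn a, List.length_ofFn, hp⟩, ?_⟩)
    exact List.ofFn_injective (he _)

lemma entropy_eq_neg_integral [IsProbabilityMeasure μ] (hμ : μ gaussSet = 1)
    (hinv : GaussInvariant μ) (hG : IsGibbs φ μ) (hφ : Integrable φ μ) {h : ℝ}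
    (hent : HasEntropy μ h) : h = -∫ x, φ x ∂μ := by
  obtain ⟨C, hC0, hC⟩ := hG.abs_log_cylinder_sub_le
  have hT := hinv.measurePreserving
  have key : ∀ n : ℕ, 1 ≤ n →
      |∑' l : Word n, Real.negMulLog (μ (_root_.cylinder l.1)).toReal + n * ∫ x, φ x ∂μ| ≤ C := by
    intro n hn
    set G : (Fin n → ℕ) → ℝ := fun a => -Real.log (μ (_root_.cylinder (List.ofFn a))).toReal
    have hGm : Measurable G := measurable_of_countable G
    have hS : Integrable (birkhoffSum gaussMap φ n) μ :=
      integrable_finsetSum _ fun k _ => (hT.iterate k).integrable_comp_of_integrable hφ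
    have hbd : ∀ᵐ x ∂μ, ‖G (digitWord n x) + birkhoffSum gaussMap φ n x‖ ≤ C := by
      filter_upwards [ae_mem_gaussSet hμ] with x hx
      rw [Real.norm_eq_abs, ← abs_neg, neg_add, neg_neg, ← sub_eq_add_neg]
      exact hC n hn x hx
    have hi1 : Integrable (fun x => G (digitWord n x) + birkhoffSum gaussMap φ n x) μ :=
      (integrable_const C).mono'
        ((hGm.comp (measurable_digitWord n)).aestronglyMeasurable.add hS.1) hbd
    have hi2 : Integrable (fun x => G (digitWord n x)) μ := by
      exact (hi1.sub hS).congr (ae_of_all _ fun x => by simp)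
    have e1 : ∫ x, G (digitWord n x) ∂μ =
        ∑' l : Word n, Real.negMulLog (μ (_root_.cylinder l.1)).toReal := by
      rw [tsum_word_eq_tsum_fin (F := fun l => Real.negMulLog (μ (_root_.cylinder l)).toReal)
        fun l hl => by simp [cylinder_eq_empty_of_not_pos hl]]
      rw [← integral_map (measurable_digitWord n).aemeasurable hGm.aestronglyMeasurable,
        integral_countable ((integrable_map_measure hGm.aestronglyMeasurable
          (measurable_digitWord n).aemeasurable).2 hi2)]
      refine tsum_congr fun a => ?_
      rw [Measure.real, map_digitWord_singleton hμ, smul_eq_mul, Real.negMulLog]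
      ring
    rw [← e1, ← integral_birkhoffSum hT hφ, ← integral_add hi2 hS]
    simpa using norm_integral_le_of_norm_le_const hbd
  have hlim : Tendsto (fun n : ℕ =>
      (∑' l : Word n, Real.negMulLog (μ (_root_.cylinder l.1)).toReal) / (n : ℝ)) atTop
      (𝓝 (-∫ x, φ x ∂μ)) := by
    rw [tendsto_iff_dist_tendsto_zero]
    refine squeeze_zero' (Eventually.of_forall fun _ => dist_nonneg) ?_
      (tendsto_const_div_atTop_nhds_zero_nat C)
    filter_upwards [eventually_ge_atTop 1] with n hn
    have hn0 : (0 : ℝ) < n := by exact_mod_cast hn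
    rw [Real.dist_eq, sub_neg_eq_add, le_div_iff₀ hn0, ← abs_of_pos hn0, ← abs_mul, abs_of_pos hn0]
    rw [add_mul, div_mul_cancel₀ _ hn0.ne', mul_comm (∫ x, φ x ∂μ)]
    exact key n hn
  exact tendsto_nhds_unique hent hlim

end Entropy

section LargeDeviations

variable {φ f g : ℝ → ℝ} {μ : Measure ℝ} [IsProbabilityMeasure μ]

lemma integrable_min_const (hg : AEMeasurable g μ) (hg0 : ∀ᵐ x ∂μ, 0 ≤ g x) (M : ℕ) :
    Integrable (fun x => min (g x) M) μ := by
  refine (integrable_const (M : ℝ)).mono' (hg.min aemeasurable_const).aestronglyMeasurable ?_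
  filter_upwards [hg0] with x hx
  rw [Real.norm_of_nonneg (le_min hx M.cast_nonneg)]
  exact min_le_right _ _

lemma exists_le_integral_min (hg : AEMeasurable g μ) (hg0 : ∀ᵐ x ∂μ, 0 ≤ g x)
    (hgi : ¬ Integrable g μ) (R : ℝ) : ∃ M : ℕ, R ≤ ∫ x, min (g x) M ∂μ := by
  have htop : ∫⁻ x, ENNReal.ofReal (g x) ∂μ = ⊤ := by
    by_contra h
    exact hgi ⟨hg.aestronglyMeasurable, (hasFiniteIntegral_iff_ofReal hg0).2 (Ne.lt_top h)⟩
  have hlim : Tendsto (fun M : ℕ => ∫⁻ x, ENNReal.ofReal (min (g x) M) ∂μ) atTop (𝓝 ⊤) := by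
    rw [← htop]
    refine lintegral_tendsto_of_tendsto_of_monotone
      (fun M => (hg.min aemeasurable_const).ennreal_ofReal) (ae_of_all _ fun x M M' h => ?_)
      (ae_of_all _ fun x => ?_)
    · exact ENNReal.ofReal_le_ofReal (min_le_min le_rfl (Nat.cast_le.2 h))
    · refine tendsto_const_nhds.congr' ?_
      filter_upwards [eventually_ge_atTop ⌈g x⌉₊] with M hM
      rw [min_eq_left (Nat.ceil_le.1 hM)]
  obtain ⟨M, hM⟩ := ((tendsto_order.1 hlim).1 (ENNReal.ofReal R) ENNReal.ofReal_lt_top).exists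
  refine ⟨M, ?_⟩
  rw [← ofReal_integral_eq_lintegral_ofReal (integrable_min_const hg hg0 M)
    (hg0.mono fun x hx => le_min hx M.cast_nonneg)] at hM
  exact (ENNReal.ofReal_lt_ofReal_iff'.1 hM).1.le

lemma measure_abs_birkhoffSum_gaussMap_sub_gt_le (hμ : μ gaussSet = 1)
    (hinv : GaussInvariant μ) (hG : IsGibbs φ μ) {B : ℝ} (hB : SumDistortion f B) {t₀ : ℝ}
    (ht₀ : 0 < t₀) (hexp : Integrable (fun x => Real.exp (t₀ * f x)) μ)
    (hexp' : Integrable (fun x => Real.exp (-t₀ * f x)) μ) {η : ℝ} (hη : 0 < η) :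
    ∃ δ > (0 : ℝ), ∃ n₁ : ℕ, ∀ n : ℕ, n₁ ≤ n →
      μ {x | n * η < |birkhoff f n x - n * ∫ y, f y ∂μ|} ≤
        ENNReal.ofReal (Real.exp (-(n * δ))) := by
  obtain ⟨K, hK⟩ := exists_quasiBernoulli hμ hinv hG
  exact measure_abs_birkhoffSum_sub_gt_le hK (hB.codedBy (ae_mem_gaussSet hμ)) hB.nonneg ht₀
    hexp hexp' hη

lemma integrable_exp_mul_min_neg_gaussPsi (hμ : μ gaussSet = 1) (M : ℕ) (t : ℝ) :
    Integrable (fun x => Real.exp (t * min (-gaussPsi x) M)) μ := by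
  refine (integrable_const (Real.exp (|t| * M))).mono' ?_ ?_
  · have := measurable_gaussPsi
    exact Measurable.aestronglyMeasurable (by fun_prop)
  · filter_upwards [ae_mem_gaussSet hμ] with x hx
    have h0 := gaussPsi_neg hx
    rw [Real.norm_of_nonneg (Real.exp_pos _).le, Real.exp_le_exp]
    have h1 : 0 ≤ min (-gaussPsi x) M := le_min (by linarith) M.cast_nonneg
    calc t * min (-gaussPsi x) M ≤ |t| * min (-gaussPsi x) M := by
          gcongr
          exact le_abs_self t
      _ ≤ |t| * M := by
          gcongr
          exact min_le_right _ _

/-- The case of a finite Lyapunov exponent. -/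
lemma large_deviation_of_integral_eq_zero (hμ : μ gaussSet = 1) (hinv : GaussInvariant μ)
    (hG : IsGibbs φ μ) {s B t₀ : ℝ} (hB : SumDistortion (fun x => φ x - s * gaussPsi x) B)
    (ht₀ : 0 < t₀) (hexp : Integrable (fun x => Real.exp (t₀ * (φ x - s * gaussPsi x))) μ)
    (hexp' : Integrable (fun x => Real.exp (-t₀ * (φ x - s * gaussPsi x))) μ)
    (h0 : ∫ x, (φ x - s * gaussPsi x) ∂μ = 0) {ε : ℝ} (hε : 0 < ε) :
    ∃ δ > (0 : ℝ), ∃ n₁ : ℕ, ∀ n : ℕ, n₁ ≤ n →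
      μ {x | ε < |birkhoff φ n x / birkhoff gaussPsi n x - s|} ≤
        ENNReal.ofReal (Real.exp (-(n * δ))) := by
  have hlog2 : 0 < Real.log 2 := Real.log_pos (by norm_num)
  obtain ⟨δ, hδ, n₁, h⟩ := measure_abs_birkhoffSum_gaussMap_sub_gt_le hμ hinv hG hB ht₀ hexp hexp'
    (η := ε * (Real.log 2 / 2)) (by positivity)
  refine ⟨δ, hδ, max n₁ 2, fun n hn => le_trans (measure_mono_ae ?_) (h n (le_of_max_le_left hn))⟩
  have hn2 : (2 : ℝ) ≤ n := by exact_mod_cast le_of_max_le_right hn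
  filter_upwards [ae_mem_gaussSet hμ] with x hx hxε
  change ε < |birkhoff φ n x / birkhoff gaussPsi n x - s| at hxε
  change n * (ε * (Real.log 2 / 2)) <
    |birkhoff (fun x => φ x - s * gaussPsi x) n x - n * ∫ x, (φ x - s * gaussPsi x) ∂μ|
  have hψ := birkhoff_gaussPsi_le hx n
  have hψ1 : n * (Real.log 2 / 2) ≤ -birkhoff gaussPsi n x := by nlinarith
  have hψ0 : birkhoff gaussPsi n x < 0 := by
    have : 0 < n * (Real.log 2 / 2) := by positivity
    linarith
  have e : birkhoff (fun x => φ x - s * gaussPsi x) n x =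
      (birkhoff φ n x / birkhoff gaussPsi n x - s) * birkhoff gaussPsi n x := by
    rw [sub_mul, div_mul_cancel₀ _ hψ0.ne]
    simp only [birkhoff, Finset.sum_sub_distrib, Finset.mul_sum]
  rw [h0, mul_zero, sub_zero, e, abs_mul, abs_of_neg hψ0]
  calc n * (ε * (Real.log 2 / 2)) = ε * (n * (Real.log 2 / 2)) := by ring
    _ ≤ ε * -birkhoff gaussPsi n x := by gcongr
    _ < _ := by
      refine mul_lt_mul_of_pos_right hxε (by linarith)

/-- The case of an infinite Lyapunov exponent. -/
lemma large_deviation_of_not_integrable (hμ : μ gaussSet = 1) (hinv : GaussInvariant μ)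
    (hG : IsGibbs φ μ) {B B' t₀ : ℝ} (hB : SumDistortion φ B) (hB' : SumDistortion gaussPsi B')
    (ht₀ : 0 < t₀) (hexp : Integrable (fun x => Real.exp (t₀ * φ x)) μ)
    (hexp' : Integrable (fun x => Real.exp (-t₀ * φ x)) μ)
    (hψ : ¬ Integrable gaussPsi μ) {ε : ℝ} (hε : 0 < ε) :
    ∃ δ > (0 : ℝ), ∃ n₁ : ℕ, ∀ n : ℕ, n₁ ≤ n →
      μ {x | ε < |birkhoff φ n x / birkhoff gaussPsi n x|} ≤
        ENNReal.ofReal (Real.exp (-(n * δ))) := by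
  set m := ∫ x, φ x ∂μ
  obtain ⟨M, hM⟩ := exists_le_integral_min (μ := μ) measurable_gaussPsi.neg.aemeasurable
    ((ae_mem_gaussSet hμ).mono fun x hx => neg_nonneg.2 (gaussPsi_neg hx).le)
    (fun h => hψ (by simpa using h.neg)) (1 + (|m| + 1) / ε)
  set c := ∫ x, min (-gaussPsi x) M ∂μ with hc
  obtain ⟨δ₁, hδ₁, n₁, h₁⟩ := measure_abs_birkhoffSum_gaussMap_sub_gt_le hμ hinv hG hB ht₀ hexp
    hexp' one_pos
  obtain ⟨δ₂, hδ₂, n₂, h₂⟩ := measure_abs_birkhoffSum_gaussMap_sub_gt_le hμ hinv hG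
    (hB'.min_neg M) one_pos (integrable_exp_mul_min_neg_gaussPsi hμ M 1)
    (integrable_exp_mul_min_neg_gaussPsi hμ M (-1)) one_pos
  have hδ : 0 < min δ₁ δ₂ := lt_min hδ₁ hδ₂
  refine ⟨min δ₁ δ₂ / 2, by positivity,
    max (max n₁ n₂) ⌈Real.log 2 / (min δ₁ δ₂ / 2)⌉₊, fun n hn => ?_⟩
  simp only [max_le_iff] at hn
  have hsub : ({x | ε < |birkhoff φ n x / birkhoff gaussPsi n x|} : Set ℝ) ≤ᵐ[μ]
      ({x | n * 1 < |birkhoff φ n x - n * m|} ∪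
        {x | n * 1 < |birkhoff (fun x => min (-gaussPsi x) M) n x - n * c|} : Set ℝ) := by
    filter_upwards with x hx
    change ε < |birkhoff φ n x / birkhoff gaussPsi n x| at hx
    by_contra hcon
    have h12 : ¬ (n * 1 < |birkhoff φ n x - n * m| ∨
      n * 1 < |birkhoff (fun x => min (-gaussPsi x) M) n x - n * c|) := hcon
    rw [mul_one, not_or, not_lt, not_lt] at h12
    obtain ⟨hc1, hc2⟩ := h12
    have hn0 : (0 : ℝ) ≤ n := n.cast_nonneg
    have hle : birkhoff (fun x => min (-gaussPsi x) M) n x ≤ -birkhoff gaussPsi n x := by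
      unfold birkhoff
      rw [← Finset.sum_neg_distrib]
      exact Finset.sum_le_sum fun k _ => min_le_left _ _
    have hnum : |birkhoff φ n x| ≤ n * (|m| + 1) := by
      have := abs_sub_abs_le_abs_sub (birkhoff φ n x) (n * m)
      rw [abs_mul, abs_of_nonneg hn0] at this
      linarith
    have hden : n * ((|m| + 1) / ε) ≤ |birkhoff gaussPsi n x| := by
      have h3 := (abs_le.1 hc2).1
      have h4 : n * (1 + (|m| + 1) / ε) ≤ n * c := mul_le_mul_of_nonneg_left hM hn0
      have h5 := neg_le_abs (birkhoff gaussPsi n x)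
      linarith
    have hpos : 0 < |birkhoff gaussPsi n x| := by
      rw [abs_pos]
      intro h0
      rw [h0, div_zero, abs_zero] at hx
      exact lt_asymm hx hε
    rw [abs_div, lt_div_iff₀ hpos] at hx
    have h6 : ε * (n * ((|m| + 1) / ε)) ≤ ε * |birkhoff gaussPsi n x| := by gcongr
    have h7 : ε * (n * ((|m| + 1) / ε)) = n * (|m| + 1) := by field_simp
    linarith
  refine (measure_mono_ae hsub).trans ((measure_union_le _ _).trans
    ((add_le_add (h₁ n hn.1.1) (h₂ n hn.1.2)).trans ?_))
  rw [← ENNReal.ofReal_add (Real.exp_pos _).le (Real.exp_pos _).le]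
  exact ENNReal.ofReal_le_ofReal (exp_neg_add_exp_neg_le hδ (min_le_left _ _) (min_le_right _ _)
    hn.2)

lemma lyapunov_eq_neg_integral (μ : Measure ℝ) : lyapunov μ = -∫ x, gaussPsi x ∂μ := by
  rw [lyapunov, ← integral_neg]
  simp only [logAbsDerivGauss_eq]

lemma integral_gaussPsi_neg (hμ : μ gaussSet = 1) (hψ : Integrable gaussPsi μ) :
    ∫ x, gaussPsi x ∂μ < 0 := by
  rw [← neg_pos, ← integral_neg]
  have hpos : ∀ᵐ x ∂μ, 0 < -gaussPsi x :=
    (ae_mem_gaussSet hμ).mono fun x hx => neg_pos.2 (gaussPsi_neg hx)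
  refine lt_of_le_of_ne (integral_nonneg_of_ae (hpos.mono fun x hx => hx.le)) fun h => ?_
  have h0 := (integral_eq_zero_iff_of_nonneg_ae (hpos.mono fun x hx => hx.le) hψ.neg).1 h.symm
  have hfalse : ∀ᵐ x ∂μ, False := by
    filter_upwards [hpos, h0] with x h1 h2
    exact h1.ne' h2
  exact hfalse.exists.elim fun _ h => h

end LargeDeviations

/-- Large deviations for the dimension quotient: with
`s = h_{μ_φ}/λ_{μ_φ}`, for every `ε > 0` there are `δ > 0` and `n₁` with
`μ_φ({x : |S_nφ(x)/S_nψ(x) - s| > ε}) ≤ e^{-nδ}` for all `n ≥ n₁`. -/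
theorem gibbs_large_deviation_dimension
    (φ : ℝ → ℝ) (μ : MeasureTheory.Measure ℝ) [MeasureTheory.IsProbabilityMeasure μ]
    (hμX : μ gaussSet = 1) (hinv : GaussInvariant μ)
    (hφH : LocHolder φ) (hφ0 : ∀ x ∈ gaussSet, φ x ≤ 0) (hP : HasPressure φ 0)
    (hGibbs : IsGibbs φ μ)
    (h : ℝ) (hent : HasEntropy μ h)
    (hfin : ∃ t₀ > (0:ℝ), ∀ t : ℝ, |t| < t₀ →
      PressureFinite fun x => t * (φ x - (h / lyapunov μ) * gaussPsi x) + φ x) :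
    ∀ ε > (0:ℝ), ∃ δ > (0:ℝ), ∃ n₁ : ℕ, ∀ n : ℕ, n₁ ≤ n →
      (μ {x | ε < |birkhoff φ n x / birkhoff gaussPsi n x - h / lyapunov μ|}).toReal
        ≤ Real.exp (-((n : ℝ) * δ)) := by
  intro ε hε
  obtain ⟨t₀, ht₀, hfin⟩ := hfin
  have hX := ae_mem_gaussSet hμX
  obtain ⟨B, hB⟩ := hφH.sumDistortion
  obtain ⟨B', hB'⟩ := locHolder_gaussPsi.sumDistortion
  have hφm := hφH.aemeasurable hX
  have hf := hB.sub_mul hB' (h / lyapunov μ)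
  have hfm : AEMeasurable (fun x => φ x - h / lyapunov μ * gaussPsi x) μ :=
    hφm.sub (measurable_gaussPsi.aemeasurable.const_mul _)
  have hexp : ∀ t : ℝ, |t| < t₀ →
      Integrable (fun x => Real.exp (t * (φ x - h / lyapunov μ * gaussPsi x))) μ :=
    fun t ht => integrable_exp_mul_of_pressureFinite hμX hGibbs hfm hf (hfin t ht)
  have h₁ := hexp (t₀ / 2) (by rw [abs_of_pos (by positivity)]; linarith)
  have h₂ := hexp (-(t₀ / 2)) (by rw [abs_neg, abs_of_pos (by positivity)]; linarith)
  suffices H : ∃ δ > (0:ℝ), ∃ n₁ : ℕ, ∀ n : ℕ, n₁ ≤ n →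
      μ {x | ε < |birkhoff φ n x / birkhoff gaussPsi n x - h / lyapunov μ|} ≤
        ENNReal.ofReal (Real.exp (-((n : ℝ) * δ))) by
    obtain ⟨δ, hδ, n₁, H⟩ := H
    exact ⟨δ, hδ, n₁, fun n hn => ENNReal.toReal_le_of_le_ofReal (Real.exp_pos _).le (H n hn)⟩
  by_cases hψ : Integrable gaussPsi μ
  · refine large_deviation_of_integral_eq_zero hμX hinv hGibbs hf (half_pos ht₀) h₁ h₂ ?_ hε
    have hfi : Integrable (fun x => φ x - h / lyapunov μ * gaussPsi x) μ := by
      simpa using ProbabilityTheory.integrable_pow_of_integrable_exp_mul (half_pos ht₀).ne' h₁ h₂ 1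
    have hφi : Integrable φ μ :=
      (hfi.add (hψ.const_mul (h / lyapunov μ))).congr (ae_of_all _ fun x => by simp)
    have hne := (integral_gaussPsi_neg hμX hψ).ne
    rw [integral_sub hφi (hψ.const_mul _), integral_const_mul,
      entropy_eq_neg_integral hμX hinv hGibbs hφi hent, lyapunov_eq_neg_integral]
    field_simp
    ring
  · have hs : h / lyapunov μ = 0 := by
      rw [lyapunov_eq_neg_integral, integral_undef hψ, neg_zero, div_zero]
    simp only [hs, zero_mul, sub_zero] at h₁ h₂ ⊢
    exact large_deviation_of_not_integrable hμX hinv hGibbs hB hB' (half_pos ht₀) h₁ h₂ hψ hε
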